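/- arXiv:0810.0674 — 8 statements merged into one kernel-verified Lean document; each statement's English description precedes it below -/
import Mathlib

section
/- Let G=(V,E) be a finite simple undirected graph with positive integer edge capacities c_e and commodities S_1,…,S_k (finite sets of terminals, terminal i located at vertex r_i, distinct terminals of the same commodity at distinct vertices). Suppose there exist functions d_a : V×V → [0,1] for a=1,…,k with d_a(u,u)=0, d_a(u,v)=d_a(v,u), d_a(u,v) ≤ d_a(u,w)+d_a(w,v) for all u,v,w, d_a(r_i,r_j) ≥ 1 for all distinct i,j ∈ S_a, and Σ_a d_a(u,v) ≤ c_e for every edge e={u,v}. Then for every ε > 0 there exists a fractional laminar cut family for the terminal set T = ∪_a S_a such that for every commodity a and all distinct i,j ∈ S_a, either r_j belongs to no cut of C_i or r_i belongs to no cut of C_j, and whose load on every edge e is at most 8c_e + ε. -/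
open Finset

/-- A fractional laminar cut family for a terminal set `T` (terminal `i`
located at vertex `r i`): a finite indexed family of cuts (subsets of `V`)
with positive weights, each cut owned by a terminal, such that the collection
of cuts is laminar, every cut owned by `i` contains `r i`, and the weights of
the cuts owned by each terminal sum to `1`. -/
structure FracLaminarFamily (V T : Type) [DecidableEq V] [Fintype T]
    [DecidableEq T] (r : T → V) where
  n : ℕ
  cut : Fin n → Finset V
  wt : Fin n → ℝ
  owner : Fin n → T
  wt_pos : ∀ j, 0 < wt j
  laminar : ∀ j j', (cut j ∩ cut j').Nonempty → cut j ⊆ cut j' ∨ cut j' ⊆ cut j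
  root_mem : ∀ j, r (owner j) ∈ cut j
  wt_sum : ∀ i : T, ∑ j ∈ univ.filter (fun j => owner j = i), wt j = 1

/-- The load of a fractional laminar cut family on the pair (edge) `{u, v}`:
the total weight of the cuts containing exactly one of `u` and `v`. -/
noncomputable def FracLaminarFamily.load {V T : Type} [DecidableEq V]
    [Fintype T] [DecidableEq T] {r : T → V} (F : FracLaminarFamily V T r)
    (u v : V) : ℝ :=
  ∑ j : Fin F.n, if ¬((u ∈ F.cut j) ↔ (v ∈ F.cut j)) then F.wt j else 0

/-- `1` if the set `A` separates `u` from `v`, and `0` otherwise. -/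
def cutSep {V : Type*} [DecidableEq V] (A : Finset V) (u v : V) : ℕ :=
  if (u ∈ A ↔ v ∈ A) then 0 else 1

/-- `B` is contained in `A` or disjoint from it. -/
def InOrOut {V : Type*} (B A : Finset V) : Prop :=
  B ⊆ A ∨ Disjoint B A

section Cuts

variable {V : Type*} [DecidableEq V] {A B C : Finset V}

theorem cutSep_inter_add_union (A B : Finset V) (u v : V) :
    cutSep (A ∩ B) u v + cutSep (B ∪ A) u v ≤ cutSep A u v + cutSep B u v := by
  by_cases h1 : u ∈ A <;> by_cases h2 : v ∈ A <;> by_cases h3 : u ∈ B <;>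
    by_cases h4 : v ∈ B <;> simp [cutSep, h1, h2, h3, h4]

theorem cutSep_sdiff_add_sdiff (A B : Finset V) (u v : V) :
    cutSep (A \ B) u v + cutSep (B \ A) u v ≤ cutSep A u v + cutSep B u v := by
  by_cases h1 : u ∈ A <;> by_cases h2 : v ∈ A <;> by_cases h3 : u ∈ B <;>
    by_cases h4 : v ∈ B <;> simp [cutSep, h1, h2, h3, h4]

theorem InOrOut.inter (hA : InOrOut C A) (hB : InOrOut C B) : InOrOut C (A ∩ B) := by
  rcases hA with hA | hA
  · rcases hB with hB | hB
    · exact Or.inl (subset_inter hA hB)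
    · exact Or.inr (hB.mono_right inter_subset_right)
  · exact Or.inr (hA.mono_right inter_subset_left)

theorem InOrOut.union (hA : InOrOut C A) (hB : InOrOut C B) : InOrOut C (A ∪ B) := by
  rcases hA with hA | hA
  · exact Or.inl (hA.trans subset_union_left)
  · rcases hB with hB | hB
    · exact Or.inl (hB.trans subset_union_right)
    · exact Or.inr (disjoint_union_right.2 ⟨hA, hB⟩)

theorem InOrOut.sdiff (hA : InOrOut C A) (hB : InOrOut C B) : InOrOut C (A \ B) := by
  rcases hA with hA | hA
  · rcases hB with hB | hB
    · exact Or.inr (disjoint_sdiff.mono_left hB)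
    · exact Or.inl (subset_sdiff.2 ⟨hA, hB⟩)
  · exact Or.inr (hA.mono_right sdiff_subset)

/-- Replacing two members of an indexed family does not increase its load if it does not
increase the load of the pair. -/
theorem sum_cutSep_update_le {J : Type*} [DecidableEq J] (W : Finset J) (X : J → Finset V)
    {i z : J} (hi : i ∈ W) (hz : z ∈ W) (hiz : i ≠ z) (u v : V)
    (h : cutSep A u v + cutSep B u v ≤ cutSep (X i) u v + cutSep (X z) u v) :
    ∑ j ∈ W, cutSep (Function.update (Function.update X i A) z B j) u v ≤
      ∑ j ∈ W, cutSep (X j) u v := by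
  have hz' : z ∈ W.erase i := mem_erase.2 ⟨hiz.symm, hz⟩
  rw [← add_sum_erase W _ hi, ← add_sum_erase _ _ hz',
    ← add_sum_erase W (fun j => cutSep (X j) u v) hi,
    ← add_sum_erase _ (fun j => cutSep (X j) u v) hz']
  have : ∑ j ∈ (W.erase i).erase z,
      cutSep (Function.update (Function.update X i A) z B j) u v =
      ∑ j ∈ (W.erase i).erase z, cutSep (X j) u v := by
    refine sum_congr rfl fun j hj => ?_
    simp only [mem_erase] at hj
    rw [Function.update_of_ne hj.1, Function.update_of_ne hj.2.1]
  rw [this, Function.update_self, Function.update_of_ne hiz, Function.update_self]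
  omega

/-- A family of sets in which the members of `P` are about to be made final while the members
of `U` may still change; `𝓕` is the collection of sets which are final already. -/
structure Pending {J : Type*} [DecidableEq J] (r : J → V) (con : J → J → Prop)
    (𝓕 : Set (Finset V)) (U P : Finset J) (X : J → Finset V) : Prop where
  root : ∀ j, r j ∈ X j
  disj : ∀ i ∈ U ∪ P, ∀ j ∈ U ∪ P, con i j → Disjoint (X i) (X j)
  pairwise : ∀ i ∈ P, ∀ j ∈ P, i ≠ j → Disjoint (X i) (X j)
  root_swap : ∀ i ∈ P, ∀ z ∈ U, r z ∈ X i → r i ∈ X z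
  nest : ∀ B ∈ 𝓕, ∀ j ∈ U ∪ P, InOrOut B (X j)

section Pending

variable {J : Type*} [DecidableEq J] {r : J → V} {con : J → J → Prop}
  {𝓕 : Set (Finset V)} {U P : Finset J} {X : J → Finset V}

theorem Pending.sdiff (h : Pending r con 𝓕 U P X) (hUP : Disjoint U P) {i z : J} (hi : i ∈ P)
    (hz : z ∈ U) (hiz : r i ∉ X z) :
    Pending r con 𝓕 U P
      (Function.update (Function.update X i (X i \ X z)) z (X z \ X i)) := by
  have hne : i ≠ z := fun e => disjoint_left.1 hUP hz (e ▸ hi)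
  set Y := Function.update (Function.update X i (X i \ X z)) z (X z \ X i) with hY
  have hYi : Y i = X i \ X z := by simp [hY, hne]
  have hYz : Y z = X z \ X i := by simp [hY]
  have hYo : ∀ j, j ≠ i → j ≠ z → Y j = X j := fun j h1 h2 => by simp [hY, h1, h2]
  have hsub : ∀ j, Y j ⊆ X j := by
    intro j
    by_cases h1 : j = i
    · rw [h1, hYi]; exact sdiff_subset
    by_cases h2 : j = z
    · rw [h2, hYz]; exact sdiff_subset
    rw [hYo j h1 h2]
  have hzi : r z ∉ X i := fun h' => hiz (h.root_swap i hi z hz h')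
  refine ⟨fun j => ?_, fun a ha b hb hab => (h.disj a ha b hb hab).mono (hsub a) (hsub b),
    fun a ha b hb hab => (h.pairwise a ha b hb hab).mono (hsub a) (hsub b),
    fun a ha b hb hab => ?_, fun B hB j hj => ?_⟩
  · by_cases h1 : j = i
    · rw [h1, hYi]; exact mem_sdiff.2 ⟨h.root i, hiz⟩
    by_cases h2 : j = z
    · rw [h2, hYz]; exact mem_sdiff.2 ⟨h.root z, hzi⟩
    rw [hYo j h1 h2]; exact h.root j
  · have h3 := h.root_swap a ha b hb (hsub a hab)
    have hbi : b ≠ i := fun e => disjoint_left.1 hUP hb (e ▸ hi)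
    by_cases h2 : b = z
    · subst h2
      by_cases h1 : a = i
      · subst h1; exact absurd h3 hiz
      · rw [hYz]
        exact mem_sdiff.2 ⟨h3, disjoint_left.1 (h.pairwise a ha i hi h1) (h.root a)⟩
    · rw [hYo b hbi h2]; exact h3
  · have hi' := h.nest B hB i (mem_union_right _ hi)
    have hz' := h.nest B hB z (mem_union_left _ hz)
    by_cases h1 : j = i
    · rw [h1, hYi]; exact hi'.sdiff hz'
    by_cases h2 : j = z
    · rw [h2, hYz]; exact hz'.sdiff hi'
    rw [hYo j h1 h2]; exact h.nest B hB j hj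

theorem Pending.inter_union (h : Pending r con 𝓕 U P X) (hcon : ∀ i j, con i j → con j i)
    (hUP : Disjoint U P)
    (hroot : ∀ i ∈ P, ∀ z ∈ U, ¬ Disjoint (X i) (X z) → r i ∈ X z) {i z : J} (hi : i ∈ P)
    (hz : z ∈ U) (hiz : r i ∈ X z) :
    Pending r con 𝓕 U P
      (Function.update (Function.update X i (X i ∩ X z)) z (X z ∪ X i)) := by
  have hne : i ≠ z := fun e => disjoint_left.1 hUP hz (e ▸ hi)
  set Y := Function.update (Function.update X i (X i ∩ X z)) z (X z ∪ X i) with hY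
  have hYi : Y i = X i ∩ X z := by simp [hY, hne]
  have hYz : Y z = X z ∪ X i := by simp [hY]
  have hYo : ∀ j, j ≠ i → j ≠ z → Y j = X j := fun j h1 h2 => by simp [hY, h1, h2]
  have hsub : ∀ j, j ≠ z → Y j ⊆ X j := by
    intro j h2
    by_cases h1 : j = i
    · rw [h1, hYi]; exact inter_subset_left
    rw [hYo j h1 h2]
  have hPz : ∀ a ∈ P, a ≠ z := fun a ha e => disjoint_left.1 hUP hz (e ▸ ha)
  have hzU := mem_union_left P hz
  have hiU := mem_union_right U hi
  have hirr : ¬ con i z := fun hc =>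
    disjoint_left.1 (h.disj i hiU z hzU hc) (h.root i) hiz
  have hzz : ∀ b ∈ U ∪ P, con z b → b ≠ z → Disjoint (Y z) (Y b) := by
    intro b hb hc hbz
    have hzb := h.disj z hzU b hb hc
    have hbi : b ≠ i := fun e => hirr (hcon _ _ (e ▸ hc))
    rw [hYz, hYo b hbi hbz, disjoint_union_left]
    refine ⟨hzb, ?_⟩
    rcases mem_union.1 hb with hb | hb
    · by_contra hcon'
      exact disjoint_left.1 hzb hiz (hroot i hi b hb hcon')
    · exact h.pairwise i hi b hb hbi.symm
  refine ⟨fun j => ?_, fun a ha b hb hab => ?_,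
    fun a ha b hb hab =>
      (h.pairwise a ha b hb hab).mono (hsub a (hPz a ha)) (hsub b (hPz b hb)),
    fun a ha b hb hab => ?_, fun B hB j hj => ?_⟩
  · by_cases h1 : j = i
    · rw [h1, hYi]; exact mem_inter.2 ⟨h.root i, hiz⟩
    by_cases h2 : j = z
    · rw [h2, hYz]; exact mem_union_left _ (h.root z)
    rw [hYo j h1 h2]; exact h.root j
  · by_cases h1 : a = z
    · by_cases h2 : b = z
      · rw [h1, h2] at hab
        exact absurd (h.root z) (disjoint_left.1 (h.disj z hzU z hzU hab) (h.root z))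
      · subst h1; exact hzz b hb hab h2
    · by_cases h2 : b = z
      · subst h2; exact (hzz a ha (hcon _ _ hab) h1).symm
      · exact (h.disj a ha b hb hab).mono (hsub a h1) (hsub b h2)
  · have h3 := h.root_swap a ha b hb (hsub a (hPz a ha) hab)
    have hbi : b ≠ i := fun e => disjoint_left.1 hUP hb (e ▸ hi)
    by_cases h2 : b = z
    · rw [h2, hYz]; exact mem_union_left _ (h2 ▸ h3)
    · rw [hYo b hbi h2]; exact h3
  · have hi' := h.nest B hB i hiU
    have hz' := h.nest B hB z hzU
    by_cases h1 : j = i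
    · rw [h1, hYi]; exact hi'.inter hz'
    by_cases h2 : j = z
    · rw [h2, hYz]; exact hz'.union hi'
    rw [hYo j h1 h2]; exact h.nest B hB j hj

/-- Pending members can be uncrossed from the changeable ones without increasing the load. -/
theorem Pending.exists_uncrossed (hcon : ∀ i j, con i j → con j i) (hUP : Disjoint U P)
    (h : Pending r con 𝓕 U P X) :
    ∃ Y : J → Finset V, Pending r con 𝓕 U P Y ∧ (∀ j, j ∉ U → j ∉ P → Y j = X j) ∧
      (∀ i ∈ P, ∀ z ∈ U, InOrOut (Y i) (Y z)) ∧
      ∀ u v, ∑ j ∈ U ∪ P, cutSep (Y j) u v ≤ ∑ j ∈ U ∪ P, cutSep (X j) u v := by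
  induction hn : ∑ i ∈ P, #(X i) using Nat.strong_induction_on generalizing X with
  | _ n ih =>
  have key : ∀ i ∈ P, ∀ z ∈ U, ∀ A B : Finset V, A ⊂ X i →
      (∀ u v, cutSep A u v + cutSep B u v ≤ cutSep (X i) u v + cutSep (X z) u v) →
      Pending r con 𝓕 U P (Function.update (Function.update X i A) z B) →
      ∃ Y : J → Finset V, Pending r con 𝓕 U P Y ∧ (∀ j, j ∉ U → j ∉ P → Y j = X j) ∧
      (∀ i ∈ P, ∀ z ∈ U, InOrOut (Y i) (Y z)) ∧
      ∀ u v, ∑ j ∈ U ∪ P, cutSep (Y j) u v ≤ ∑ j ∈ U ∪ P, cutSep (X j) u v := by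
    intro i hi z hz A B hA hAB hp
    have hPz : ∀ a ∈ P, a ≠ z := fun a ha e => disjoint_left.1 hUP hz (e ▸ ha)
    have hlt : ∑ j ∈ P, #(Function.update (Function.update X i A) z B j) < n := by
      rw [← hn]
      refine sum_lt_sum (fun j hj => ?_) ⟨i, hi, ?_⟩
      · rw [Function.update_of_ne (hPz j hj)]
        by_cases hji : j = i
        · rw [hji, Function.update_self]; exact card_le_card hA.1
        · rw [Function.update_of_ne hji]
      · rw [Function.update_of_ne (hPz i hi), Function.update_self]
        exact card_lt_card hA
    obtain ⟨Y, h1, h2, h3, h4⟩ := ih _ hlt hp rfl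
    refine ⟨Y, h1, fun j hj hj' => ?_, h3, fun u v => (h4 u v).trans ?_⟩
    · rw [h2 j hj hj', Function.update_of_ne (fun e : j = z => hj (e ▸ hz)),
        Function.update_of_ne (fun e : j = i => hj' (e ▸ hi))]
    · exact sum_cutSep_update_le _ X (mem_union_right _ hi) (mem_union_left _ hz)
        (hPz i hi) u v (hAB u v)
  by_cases hroot : ∀ i ∈ P, ∀ z ∈ U, ¬ Disjoint (X i) (X z) → r i ∈ X z
  · by_cases hnest : ∀ i ∈ P, ∀ z ∈ U, InOrOut (X i) (X z)
    · exact ⟨X, h, fun _ _ _ => rfl, hnest, fun _ _ => le_rfl⟩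
    · push Not at hnest
      obtain ⟨i, hi, z, hz, hc⟩ := hnest
      rw [InOrOut, not_or] at hc
      have hiz := hroot i hi z hz hc.2
      refine key i hi z hz _ _ ⟨inter_subset_left, fun hs => hc.1 ?_⟩
        (cutSep_inter_add_union (X i) (X z)) (h.inter_union hcon hUP hroot hi hz hiz)
      exact hs.trans inter_subset_right
  · push Not at hroot
    obtain ⟨i, hi, z, hz, hd, hiz⟩ := hroot
    refine key i hi z hz _ _ ⟨sdiff_subset, fun hs => hd ?_⟩
      (cutSep_sdiff_add_sdiff (X i) (X z)) (h.sdiff hUP hi hz hiz)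
    exact (subset_sdiff.1 hs).2

end Pending

end Cuts

section Separated

variable {V : Type*} {J : Type*} {r : J → V}

/-- The roots of the members of `R` are pairwise distinguished by the sets indexed by `R`. -/
def RootsSeparated (r : J → V) (X : J → Finset V) (R : Finset J) : Prop :=
  ∀ i ∈ R, ∀ j ∈ R, (∀ h ∈ R, r i ∈ X h ↔ r j ∈ X h) → i = j

/-- The points which belong to the same sets indexed by `R` as the point `x`. -/
def atomOf [Fintype V] [DecidableEq V] (X : J → Finset V) (R : Finset J) (x : V) : Finset V :=
  univ.filter fun v => ∀ h ∈ R, v ∈ X h ↔ x ∈ X h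

theorem mem_atomOf [Fintype V] [DecidableEq V] {X : J → Finset V} {R : Finset J} {x v : V} :
    v ∈ atomOf X R x ↔ ∀ h ∈ R, v ∈ X h ↔ x ∈ X h := by
  simp [atomOf]

theorem exists_maximal_rootsSeparated (X : J → Finset V) {U : Finset J} (hU : U.Nonempty) :
    ∃ R ⊆ U, R.Nonempty ∧ RootsSeparated r X R ∧
      ∀ R' ⊆ U, RootsSeparated r X R' → R ⊆ R' → R' = R := by
  classical
  obtain ⟨j, hj⟩ := hU
  have hmem : ({j} : Finset J) ∈ U.powerset.filter (RootsSeparated r X) := by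
    simp only [mem_filter, mem_powerset, singleton_subset_iff]
    refine ⟨hj, fun a ha b hb _ => ?_⟩
    rw [mem_singleton.1 ha, mem_singleton.1 hb]
  obtain ⟨R, hjR, hR⟩ := exists_le_maximal _ hmem
  have hR1 := mem_filter.1 hR.prop
  refine ⟨R, mem_powerset.1 hR1.1, ⟨j, hjR (mem_singleton_self j)⟩, hR1.2,
    fun R' h1 h2 h3 => ?_⟩
  exact (hR.le_of_ge (mem_filter.2 ⟨mem_powerset.2 h1, h2⟩) h3).antisymm h3

/-- If `R` is maximal, an outside member whose root lies in the atom of the root of `i ∈ R`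
contains that root. -/
theorem RootsSeparated.root_mem_of_maximal [DecidableEq V] [DecidableEq J]
    {X : J → Finset V} {U R : Finset J}
    (hroot : ∀ j, r j ∈ X j) (hR : RootsSeparated r X R) (hRU : R ⊆ U)
    (hmax : ∀ R' ⊆ U, RootsSeparated r X R' → R ⊆ R' → R' = R) {i z : J} (hi : i ∈ R)
    (hz : z ∈ U) (hzR : z ∉ R) (hzi : ∀ h ∈ R, r z ∈ X h ↔ r i ∈ X h) : r i ∈ X z := by
  by_contra hiz
  refine hzR ?_
  have hz' : ∀ a ∈ R, ¬ ∀ h ∈ insert z R, r a ∈ X h ↔ r z ∈ X h := by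
    intro a ha hh
    have hai : a = i := hR a ha i hi fun h hh' =>
      (hh h (mem_insert_of_mem hh')).trans (hzi h hh')
    subst hai
    exact hiz ((hh z (mem_insert_self z R)).2 (hroot z))
  have hsep : RootsSeparated r X (insert z R) := by
    intro a ha b hb hab
    rcases mem_insert.1 ha with ha' | ha'
    · rcases mem_insert.1 hb with hb' | hb'
      · rw [ha', hb']
      · exact absurd (fun h hh => ha' ▸ (hab h hh).symm) (hz' b hb')
    · rcases mem_insert.1 hb with hb' | hb'
      · exact absurd (hb' ▸ hab) (hz' a ha')
      · exact hR a ha' b hb' fun h hh => hab h (mem_insert_of_mem hh)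
  rw [← hmax _ (insert_subset hz hRU) hsep (subset_insert z R)]
  exact mem_insert_self z R

/-- The atoms of roots whose types have sizes of the same parity load a pair `u`, `v` no more than
the sets which define the atoms. -/
theorem sum_cutSep_atomOf_le [Fintype V] [DecidableEq V] {X : J → Finset V} {R P : Finset J}
    (hR : RootsSeparated r X R) (hPR : P ⊆ R)
    (hpar : ∀ i ∈ P, ∀ j ∈ P, #{h ∈ R | r i ∈ X h} % 2 = #{h ∈ R | r j ∈ X h} % 2) (u v : V) :
    ∑ i ∈ P, cutSep (atomOf X R (r i)) u v ≤ ∑ h ∈ R, cutSep (X h) u v := by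
  classical
  by_cases huv : ∀ h ∈ R, u ∈ X h ↔ v ∈ X h
  · have : ∑ i ∈ P, cutSep (atomOf X R (r i)) u v = 0 := by
      refine sum_eq_zero fun i _ => ?_
      rw [cutSep, if_pos]
      simp only [mem_atomOf]
      exact forall₂_congr fun h hh => by rw [huv h hh]
    omega
  have hle : ∀ w, #{i ∈ P | w ∈ atomOf X R (r i)} ≤ 1 := by
    intro w
    refine card_le_one.2 fun a ha b hb => ?_
    simp only [mem_filter, mem_atomOf] at ha hb
    exact hR a (hPR ha.1) b (hPR hb.1) fun h hh => (ha.2 h hh).symm.trans (hb.2 h hh)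
  have hsum : ∑ i ∈ P, cutSep (atomOf X R (r i)) u v ≤
      #{i ∈ P | u ∈ atomOf X R (r i)} + #{i ∈ P | v ∈ atomOf X R (r i)} := by
    rw [card_filter, card_filter, ← sum_add_distrib]
    refine sum_le_sum fun i _ => ?_
    by_cases h1 : u ∈ atomOf X R (r i) <;> by_cases h2 : v ∈ atomOf X R (r i) <;>
      simp [cutSep, h1, h2]
  have hcount : ∑ h ∈ R, cutSep (X h) u v + 2 * #{h ∈ R | u ∈ X h ∧ v ∈ X h} =
      #{h ∈ R | u ∈ X h} + #{h ∈ R | v ∈ X h} := by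
    simp only [card_filter, mul_sum, ← sum_add_distrib]
    refine sum_congr rfl fun h _ => ?_
    by_cases h1 : u ∈ X h <;> by_cases h2 : v ∈ X h <;> simp [cutSep, h1, h2]
  have hpos : 1 ≤ ∑ h ∈ R, cutSep (X h) u v := by
    push Not at huv
    obtain ⟨h, hh, hne⟩ := huv
    refine le_trans ?_ (single_le_sum (fun _ _ => Nat.zero_le _) hh)
    rw [cutSep, if_neg (by tauto)]
  have hu := hle u
  have hv := hle v
  by_cases hu0 : {i ∈ P | u ∈ atomOf X R (r i)} = ∅
  · rw [hu0, card_empty] at hsum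
    omega
  by_cases hv0 : {i ∈ P | v ∈ atomOf X R (r i)} = ∅
  · rw [hv0, card_empty] at hsum
    omega
  obtain ⟨i, hi⟩ := nonempty_iff_ne_empty.2 hu0
  obtain ⟨j, hj⟩ := nonempty_iff_ne_empty.2 hv0
  simp only [mem_filter, mem_atomOf] at hi hj
  have h1 : {h ∈ R | u ∈ X h} = {h ∈ R | r i ∈ X h} := filter_congr hi.2
  have h2 : {h ∈ R | v ∈ X h} = {h ∈ R | r j ∈ X h} := filter_congr hj.2
  have := hpar i hi.1 j hj.1
  rw [h1, h2] at hcount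
  omega

end Separated

section Integral

variable {V J T : Type*} [DecidableEq V] [Fintype J] [DecidableEq J] [DecidableEq T]

/-- The number of members of `F` of type `t` minus the number of those members of type `t` which
lie neither in `F` nor in `U`. -/
def keptBalance (τ : J → T) (U F : Finset J) (t : T) : ℤ :=
  ∑ j with τ j = t, if j ∈ F then 1 else if j ∈ U then 0 else -1

/-- A family of sets in which the members of `F` are final, the members of `U` may still change,
and all others have been discarded. The load is bounded by `L`, and for each type about half of
the members which are not in `U` are in `F`. -/
structure PartiallyFinal [Fintype T] (r : J → V) (con : J → J → Prop) (τ : J → T)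
    (L : V → V → ℕ) (U F : Finset J) (X : J → Finset V) : Prop where
  disjoint : Disjoint U F
  root : ∀ j, r j ∈ X j
  disj : ∀ i ∈ U, ∀ j ∈ U, con i j → Disjoint (X i) (X j)
  laminar : ∀ f ∈ F, ∀ g ∈ F, (X f ∩ X g).Nonempty → X f ⊆ X g ∨ X g ⊆ X f
  nest : ∀ f ∈ F, ∀ j ∈ U, InOrOut (X f) (X j)
  avoid : ∀ f ∈ F, ∀ j ∈ U, con f j → r j ∉ X f
  asymm : ∀ f ∈ F, ∀ g ∈ F, con f g → ¬ (r g ∈ X f ∧ r f ∈ X g)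
  load : ∀ u v, ∑ j ∈ U ∪ F, cutSep (X j) u v ≤ L u v
  balance : ∑ t, keptBalance τ U F t ^ 2 ≤ #Uᶜ

/-- Of two opposite choices for which members of `R` to keep, one keeps the balance small. -/
theorem exists_keptBalance_le [Fintype T] (τ : J → T) {U F R : Finset J} (hUF : Disjoint U F)
    (hRU : R ⊆ U) (hτ : ∀ i ∈ R, ∀ j ∈ R, τ i = τ j → i = j) (p : J → Prop) [DecidablePred p]
    (hbal : ∑ t, keptBalance τ U F t ^ 2 ≤ (#Uᶜ : ℤ)) :
    ∑ t, keptBalance τ (U \ R) (F ∪ {j ∈ R | p j}) t ^ 2 ≤ (#(U \ R)ᶜ : ℤ) ∨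
      ∑ t, keptBalance τ (U \ R) (F ∪ {j ∈ R | ¬ p j}) t ^ 2 ≤ (#(U \ R)ᶜ : ℤ) := by
  set x : T → ℤ := fun t => ∑ j ∈ R with τ j = t, if p j then 1 else -1 with hx
  have hstep : ∀ (q : J → Prop) [DecidablePred q] (t : T),
      keptBalance τ (U \ R) (F ∪ {j ∈ R | q j}) t =
        keptBalance τ U F t + ∑ j ∈ R with τ j = t, if q j then 1 else -1 := by
    intro q _ t
    have hR : ∑ j ∈ R with τ j = t, (if q j then 1 else -1 : ℤ) =
        ∑ j with τ j = t, if j ∈ R then (if q j then 1 else -1) else 0 := by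
      rw [← sum_filter, filter_filter]
      refine sum_congr ?_ fun _ _ => rfl
      ext j
      simp [and_comm]
    rw [keptBalance, keptBalance, hR, ← sum_add_distrib]
    refine sum_congr rfl fun j _ => ?_
    by_cases hjR : j ∈ R
    · have hjU := hRU hjR
      have hjF : j ∉ F := disjoint_left.1 hUF hjU
      by_cases hq : q j <;> simp [hjR, hjU, hjF, hq]
    · by_cases hjF : j ∈ F <;> by_cases hjU : j ∈ U <;> simp [hjR, hjU, hjF]
  have hplus : ∀ t, keptBalance τ (U \ R) (F ∪ {j ∈ R | p j}) t = keptBalance τ U F t + x t :=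
    fun t => hstep p t
  have hminus : ∀ t, keptBalance τ (U \ R) (F ∪ {j ∈ R | ¬ p j}) t =
      keptBalance τ U F t - x t := by
    intro t
    rw [hstep, hx, sub_eq_add_neg, ← sum_neg_distrib]
    congr 1
    refine sum_congr rfl fun j _ => ?_
    by_cases h : p j <;> simp [h]
  have hsq : ∑ t, x t ^ 2 ≤ #R := by
    have hxt : ∀ t, x t ^ 2 ≤ #{j ∈ R | τ j = t} := by
      intro t
      have hc : #{j ∈ R | τ j = t} ≤ 1 := card_le_one.2 fun a ha b hb => by
        simp only [mem_filter] at ha hb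
        exact hτ a ha.1 b hb.1 (ha.2.trans hb.2.symm)
      rcases Nat.le_one_iff_eq_zero_or_eq_one.1 hc with h0 | h1
      · simp [hx, card_eq_zero.1 h0]
      · obtain ⟨a, ha⟩ := card_eq_one.1 h1
        simp only [hx, ha, sum_singleton, card_singleton]
        split_ifs <;> norm_num
    calc ∑ t, x t ^ 2 ≤ ∑ t, (#{j ∈ R | τ j = t} : ℤ) := sum_le_sum fun t _ => hxt t
      _ = #R := by
        rw [card_eq_sum_card_fiberwise (f := τ) (t := univ) (fun _ _ => by simp)]
        push_cast
        rfl
  have hcard : (#(U \ R)ᶜ : ℤ) = #Uᶜ + #R := by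
    have : (U \ R)ᶜ = Uᶜ ∪ R := by
      ext j; simp; tauto
    rw [this, card_union_of_disjoint (disjoint_left.2 fun j hj hjR =>
      (mem_compl.1 hj) (hRU hjR))]
    push_cast
    rfl
  simp only [hplus, hminus, hcard]
  have e1 : ∑ t, (keptBalance τ U F t + x t) ^ 2 = ∑ t, keptBalance τ U F t ^ 2 +
      2 * ∑ t, keptBalance τ U F t * x t + ∑ t, x t ^ 2 := by
    rw [mul_sum, ← sum_add_distrib, ← sum_add_distrib]
    exact sum_congr rfl fun t _ => by ring
  have e2 : ∑ t, (keptBalance τ U F t - x t) ^ 2 = ∑ t, keptBalance τ U F t ^ 2 -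
      2 * ∑ t, keptBalance τ U F t * x t + ∑ t, x t ^ 2 := by
    rw [mul_sum, ← sum_sub_distrib, ← sum_add_distrib]
    exact sum_congr rfl fun t _ => by ring
  rw [e1, e2]
  rcases le_total (∑ t, keptBalance τ U F t * x t) 0 with h | h
  · left; linarith
  · right; linarith

/-- A step: some members of `U` are made final or discarded. -/
theorem PartiallyFinal.exists_step [Fintype V] [Fintype T] {r : J → V} {con : J → J → Prop}
    {τ : J → T} {L : V → V → ℕ} {U F : Finset J} {X : J → Finset V}
    (hcon : ∀ i j, con i j → con j i) (hτ : ∀ i j, τ i = τ j → r i = r j)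
    (h : PartiallyFinal r con τ L U F X) (hU : U.Nonempty) :
    ∃ U' F' X', #U' < #U ∧ PartiallyFinal r con τ L U' F' X' := by
  obtain ⟨R, hRU, hRne, hR, hmax⟩ := exists_maximal_rootsSeparated (r := r) X hU
  have hτR : ∀ i ∈ R, ∀ j ∈ R, τ i = τ j → i = j := fun i hi j hj hij =>
    hR i hi j hj fun _ _ => by rw [hτ i j hij]
  obtain ⟨P, hPR, hpar, hbal⟩ : ∃ P ⊆ R,
      (∀ i ∈ P, ∀ j ∈ P, #{h ∈ R | r i ∈ X h} % 2 = #{h ∈ R | r j ∈ X h} % 2) ∧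
      ∑ t, keptBalance τ (U \ R) (F ∪ P) t ^ 2 ≤ (#(U \ R)ᶜ : ℤ) := by
    rcases exists_keptBalance_le τ h.disjoint hRU hτR
      (fun j => #{h ∈ R | r j ∈ X h} % 2 = 0) h.balance with hb | hb
    · refine ⟨_, filter_subset _ _, fun i hi j hj => ?_, hb⟩
      rw [(mem_filter.1 hi).2, (mem_filter.1 hj).2]
    · refine ⟨_, filter_subset _ _, fun i hi j hj => ?_, hb⟩
      have h1 := (mem_filter.1 hi).2
      have h2 := (mem_filter.1 hj).2
      omega
  have hPU : P ⊆ U := hPR.trans hRU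
  have hFU : ∀ f ∈ F, f ∉ U := fun f hf hfU => disjoint_left.1 h.disjoint hfU hf
  have hFP : ∀ f ∈ F, f ∉ P := fun f hf hfP => hFU f hf (hPU hfP)
  have hUP : Disjoint (U \ R) P := disjoint_sdiff_self_left.mono_right hPR
  set Z : J → Finset V := fun j => if j ∈ P then atomOf X R (r j) else X j with hZ
  have hZP : ∀ j ∈ P, Z j = atomOf X R (r j) := fun j hj => if_pos hj
  have hZo : ∀ j, j ∉ P → Z j = X j := fun j hj => if_neg hj
  have hZsub : ∀ j, Z j ⊆ X j := by
    intro j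
    by_cases hj : j ∈ P
    · rw [hZP j hj]
      exact fun v hv => (mem_atomOf.1 hv j (hPR hj)).2 (h.root j)
    · rw [hZo j hj]
  have hmemU : ∀ j ∈ U \ R ∪ P, j ∈ U := fun j hj =>
    (mem_union.1 hj).elim (fun hj => (mem_sdiff.1 hj).1) fun hj => hPU hj
  have hpend : Pending r con {B | ∃ f ∈ F, B = X f} (U \ R) P Z := by
    refine ⟨fun j => ?_, fun i hi j hj hij => ?_, fun i hi j hj hij => ?_,
      fun i hi z hz hzi => ?_, ?_⟩
    · by_cases hj : j ∈ P
      · rw [hZP j hj]; exact mem_atomOf.2 fun _ _ => Iff.rfl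
      · rw [hZo j hj]; exact h.root j
    · exact (h.disj i (hmemU i hi) j (hmemU j hj) hij).mono (hZsub i) (hZsub j)
    · rw [hZP i hi, hZP j hj, disjoint_left]
      refine fun v hvi hvj => hij (hR i (hPR hi) j (hPR hj) fun a ha => ?_)
      exact (mem_atomOf.1 hvi a ha).symm.trans (mem_atomOf.1 hvj a ha)
    · rw [hZP i hi] at hzi
      rw [hZo z (disjoint_left.1 hUP hz)]
      exact hR.root_mem_of_maximal h.root hRU hmax (hPR hi) (mem_sdiff.1 hz).1
        (mem_sdiff.1 hz).2 (mem_atomOf.1 hzi)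
    · rintro _ ⟨f, hf, rfl⟩ j hj
      by_cases hjP : j ∈ P
      · rw [hZP j hjP]
        by_cases hd : Disjoint (X f) (atomOf X R (r j))
        · exact Or.inr hd
        obtain ⟨v, hvf, hvj⟩ := not_disjoint_iff.1 hd
        refine Or.inl fun w hw => mem_atomOf.2 fun a ha => ?_
        rw [← mem_atomOf.1 hvj a ha]
        rcases h.nest f hf a (hRU ha) with hs | hs
        · exact iff_of_true (hs hw) (hs hvf)
        · exact iff_of_false (disjoint_left.1 hs hw) (disjoint_left.1 hs hvf)
      · rw [hZo j hjP]; exact h.nest f hf j (hmemU j hj)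
  obtain ⟨Y, hY, hYX, hYnest, hYload⟩ := hpend.exists_uncrossed hcon hUP
  have hYF : ∀ f ∈ F, Y f = X f := fun f hf => by
    rw [hYX f (fun hm => hFU f hf (mem_sdiff.1 hm).1) (hFP f hf), hZo f (hFP f hf)]
  have hnest : ∀ f ∈ F, ∀ j ∈ U \ R ∪ P, InOrOut (Y f) (Y j) := fun f hf j hj => by
    rw [hYF f hf]; exact hY.nest _ ⟨f, hf, rfl⟩ j hj
  have hdisj : ∀ i ∈ P, ∀ j ∈ U \ R ∪ P, con i j → r j ∉ Y i := fun i hi j hj hij hm =>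
    disjoint_left.1 (hY.disj i (mem_union_right _ hi) j hj hij) hm (hY.root j)
  have hout : ∀ A B : Finset V, InOrOut A B → (A ∩ B).Nonempty → A ⊆ B := fun A B hAB hne =>
    hAB.resolve_right fun hd => by
      rw [disjoint_iff_inter_eq_empty] at hd
      exact hne.ne_empty hd
  refine ⟨U \ R, F ∪ P, Y, ?_, ?_, hY.root, fun i hi j hj => hY.disj i (mem_union_left _ hi) j
    (mem_union_left _ hj), ?_, ?_, ?_, ?_, fun u v => ?_, hbal⟩
  · obtain ⟨a, ha⟩ := hRne
    exact card_lt_card ⟨sdiff_subset, fun hs => (mem_sdiff.1 (hs (hRU ha))).2 ha⟩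
  · exact disjoint_union_right.2 ⟨h.disjoint.mono_left sdiff_subset, hUP⟩
  · intro f hf g hg hfg
    rcases mem_union.1 hf with hf | hf <;> rcases mem_union.1 hg with hg | hg
    · rw [hYF f hf, hYF g hg] at hfg ⊢
      exact h.laminar f hf g hg hfg
    · exact Or.inl (hout _ _ (hnest f hf g (mem_union_right _ hg)) hfg)
    · exact Or.inr (hout _ _ (hnest g hg f (mem_union_right _ hf)) (inter_comm (Y f) _ ▸ hfg))
    · by_cases he : f = g
      · exact Or.inl (he ▸ Subset.rfl)
      · have hd := hY.pairwise f hf g hg he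
        rw [disjoint_iff_inter_eq_empty] at hd
        exact absurd hd hfg.ne_empty
  · intro f hf j hj
    rcases mem_union.1 hf with hf | hf
    · exact hnest f hf j (mem_union_left _ hj)
    · exact hYnest f hf j hj
  · intro f hf j hj hfj
    rcases mem_union.1 hf with hf | hf
    · rw [hYF f hf]; exact h.avoid f hf j (mem_sdiff.1 hj).1 hfj
    · exact hdisj f hf j (mem_union_left _ hj) hfj
  · rintro f hf g hg hfg ⟨h1, h2⟩
    rcases mem_union.1 hf with hf | hf <;> rcases mem_union.1 hg with hg | hg
    · rw [hYF f hf] at h1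
      rw [hYF g hg] at h2
      exact h.asymm f hf g hg hfg ⟨h1, h2⟩
    · rw [hYF f hf] at h1
      exact h.avoid f hf g (hPU hg) hfg h1
    · rw [hYF g hg] at h2
      exact h.avoid g hg f (hPU hf) (hcon _ _ hfg) h2
    · exact hdisj f hf g (mem_union_right _ hg) hfg h1
  · have hd1 : Disjoint (U \ R ∪ P) F :=
      disjoint_left.2 fun j hj hjF => hFU j hjF (hmemU j hj)
    have e1 : U \ R ∪ (F ∪ P) = (U \ R ∪ P) ∪ F := by
      rw [union_assoc, union_comm P F]
    have e2 : ∑ j ∈ F, cutSep (Y j) u v = ∑ j ∈ F, cutSep (X j) u v :=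
      sum_congr rfl fun j hj => by rw [hYF j hj]
    have e3 : ∑ j ∈ U \ R, cutSep (Z j) u v = ∑ j ∈ U \ R, cutSep (X j) u v :=
      sum_congr rfl fun j hj => by rw [hZo j (disjoint_left.1 hUP hj)]
    have e4 : ∑ j ∈ P, cutSep (Z j) u v ≤ ∑ j ∈ R, cutSep (X j) u v := by
      rw [sum_congr rfl fun j hj => by rw [hZP j hj]]
      exact sum_cutSep_atomOf_le hR hPR hpar u v
    have h1 := hYload u v
    have h2 := h.load u v
    rw [sum_union h.disjoint, ← sum_sdiff hRU] at h2
    rw [sum_union hUP, sum_union hUP, e3] at h1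
    rw [e1, sum_union hd1, sum_union hUP, e2]
    omega

/-- Sets which are disjoint whenever they conflict can be replaced by a laminar family of sets
owned by about half of the indices, without increasing the load. -/
theorem exists_laminar_half [Fintype V] [Fintype T] {r : J → V} {con : J → J → Prop}
    {τ : J → T} (hcon : ∀ i j, con i j → con j i) (hτ : ∀ i j, τ i = τ j → r i = r j)
    (X : J → Finset V) (hroot : ∀ j, r j ∈ X j)
    (hdisj : ∀ i j, con i j → Disjoint (X i) (X j)) :
    ∃ (F : Finset J) (Y : J → Finset V), (∀ j, r j ∈ Y j) ∧
      (∀ f ∈ F, ∀ g ∈ F, (Y f ∩ Y g).Nonempty → Y f ⊆ Y g ∨ Y g ⊆ Y f) ∧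
      (∀ f ∈ F, ∀ g ∈ F, con f g → ¬ (r g ∈ Y f ∧ r f ∈ Y g)) ∧
      (∀ u v, ∑ j ∈ F, cutSep (Y j) u v ≤ ∑ j, cutSep (X j) u v) ∧
      ∑ t, (2 * #{j ∈ F | τ j = t} - #{j | τ j = t} : ℤ) ^ 2 ≤ Fintype.card J := by
  have main : ∀ (n : ℕ) (U F : Finset J) (Y : J → Finset V), #U = n →
      PartiallyFinal r con τ (fun u v => ∑ j, cutSep (X j) u v) U F Y →
      ∃ F' Y', PartiallyFinal r con τ (fun u v => ∑ j, cutSep (X j) u v) ∅ F' Y' := by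
    intro n
    induction n using Nat.strong_induction_on with
    | _ n ih =>
    intro U F Y hn h
    rcases U.eq_empty_or_nonempty with rfl | hU
    · exact ⟨F, Y, h⟩
    · obtain ⟨U', F', Y', hlt, h'⟩ := h.exists_step hcon hτ hU
      exact ih _ (hn ▸ hlt) U' F' Y' rfl h'
  obtain ⟨F, Y, h⟩ := main _ univ ∅ X rfl
    ⟨disjoint_empty_right _, hroot, fun i _ j _ => hdisj i j, by simp, by simp, by simp, by simp,
      by simp, by simp [keptBalance]⟩
  refine ⟨F, Y, h.root, h.laminar, h.asymm, fun u v => by simpa using h.load u v, ?_⟩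
  have hb := h.balance
  have : ∀ t, keptBalance τ ∅ F t = 2 * #{j ∈ F | τ j = t} - #{j | τ j = t} := by
    intro t
    have h1 : #{j ∈ F | τ j = t} = #{j ∈ {j | τ j = t} | j ∈ F} := by
      congr 1
      ext j
      simp [and_comm]
    rw [keptBalance, h1, card_filter, card_eq_sum_ones]
    push_cast
    rw [mul_sum, ← sum_sub_distrib]
    refine sum_congr rfl fun j _ => ?_
    by_cases hj : j ∈ F <;> simp [hj]
  simpa only [this, compl_empty, card_univ] using hb

end Integral

section Balls

/-- The number of thresholds `(m + 1) / (2 * N)` which separate two numbers. -/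
theorem card_separating_thresholds_le (N : ℕ) (hN : 0 < N) (x y : ℝ) (hxy : x ≤ y) (hx : 0 ≤ x) :
    (#{m : Fin N | ¬ (x < ((m : ℕ) + 1 : ℝ) / (2 * N) ↔ y < ((m : ℕ) + 1 : ℝ) / (2 * N))} : ℝ) ≤
      2 * N * (min y (1 / 2) - min x (1 / 2)) + 1 := by
  have hN' : (0 : ℝ) < 2 * N := by positivity
  rcases le_or_gt (1 / 2) x with h | h
  · rw [min_eq_right h, min_eq_right (h.trans hxy), filter_eq_empty_iff.2]
    · simp
    intro m _
    have hm : ((m : ℕ) + 1 : ℝ) / (2 * N) ≤ 1 / 2 := by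
      rw [div_le_iff₀ hN']
      have : ((m : ℕ) + 1 : ℝ) ≤ N := by exact_mod_cast m.2
      linarith
    simp only [not_not]
    exact iff_of_false (by linarith) (by linarith)
  rw [min_eq_left h.le]
  set z := min y (1 / 2) with hz
  have hxz : x ≤ z := le_min hxy h.le
  have hxN : 0 ≤ 2 * (N : ℝ) * x := mul_nonneg hN'.le hx
  have hzN : 0 ≤ 2 * (N : ℝ) * z := mul_nonneg hN'.le (hx.trans hxz)
  have hsub : #{m : Fin N | ¬ (x < ((m : ℕ) + 1 : ℝ) / (2 * N) ↔
      y < ((m : ℕ) + 1 : ℝ) / (2 * N))} ≤ #(Ioc ⌊2 * N * x⌋₊ ⌊2 * N * z⌋₊) := by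
    refine card_le_card_of_injOn (fun m => (m : ℕ) + 1) (fun m hm => ?_) fun a _ b _ hab => by
      simp only [add_left_inj] at hab
      exact Fin.ext hab
    have hm' : ((m : ℕ) + 1 : ℝ) ≤ N := by exact_mod_cast m.2
    simp only [coe_filter, mem_univ, true_and, Set.mem_ofPred_eq, lt_div_iff₀ hN'] at hm
    rw [coe_Ioc, Set.mem_Ioc, Nat.floor_lt hxN, Nat.le_floor_iff hzN]
    push_cast
    have h1 : x * (2 * N) ≤ y * (2 * N) := mul_le_mul_of_nonneg_right hxy hN'.le
    have h2 : x * (2 * N) < (m : ℕ) + 1 := by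
      by_contra hc
      exact hm (iff_of_false hc (by linarith))
    refine ⟨by linarith, ?_⟩
    have h3 : ((m : ℕ) + 1 : ℝ) ≤ y * (2 * N) := by
      by_contra hc
      exact hm (iff_of_true h2 (by linarith))
    rcases min_choice y (1 / 2) with h4 | h4 <;> rw [hz, h4] <;> linarith
  refine (Nat.cast_le.2 hsub).trans ?_
  have hfl : ⌊2 * N * x⌋₊ ≤ ⌊2 * N * z⌋₊ :=
    Nat.floor_le_floor (mul_le_mul_of_nonneg_left hxz hN'.le)
  rw [Nat.card_Ioc, Nat.cast_sub hfl]
  have h1 := Nat.floor_le hzN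
  have h2 := Nat.lt_floor_add_one (2 * (N : ℝ) * x)
  linarith

/-- The distances to the points `r t`, truncated at `1 / 2`, have total variation at most `d u v`
between `u` and `v` if the points `r t` are at distance at least `1` from each other. -/
theorem sum_abs_min_dist_sub_le {V T : Type*} {d : V → V → ℝ}
    (hsymm : ∀ u v, d u v = d v u) (htri : ∀ u v w, d u v ≤ d u w + d w v) (h0 : ∀ u v, 0 ≤ d u v)
    (S : Finset T) (r : T → V) (hsep : ∀ i ∈ S, ∀ j ∈ S, i ≠ j → 1 ≤ d (r i) (r j)) (u v : V) :
    ∑ t ∈ S, |min (d (r t) u) (1 / 2) - min (d (r t) v) (1 / 2)| ≤ d u v := by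
  classical
  set f : T → ℝ := fun t => |min (d (r t) u) (1 / 2) - min (d (r t) v) (1 / 2)| with hf
  have huniq : ∀ w, ∀ i ∈ S, ∀ j ∈ S, d (r i) w < 1 / 2 → d (r j) w < 1 / 2 → i = j := by
    intro w i hi j hj h1 h2
    by_contra hij
    have := hsep i hi j hj hij
    have := htri (r i) (r j) w
    rw [hsymm w] at this
    linarith
  have hone : ∀ t, f t ≤ d u v := by
    intro t
    have h1 := htri (r t) u v
    have h2 := htri (r t) v u
    rw [hsymm v u] at h1
    refine (abs_min_sub_min_le_max _ _ _ _).trans ?_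
    rw [sub_self, abs_zero]
    exact max_le (abs_le.2 ⟨by linarith, by linarith⟩) (h0 u v)
  have hzero : ∀ t, 1 / 2 ≤ d (r t) u → 1 / 2 ≤ d (r t) v → f t = 0 := by
    intro t h1 h2
    simp only [hf, min_eq_right h1, min_eq_right h2, sub_self, abs_zero]
  have hsingle : ∀ i ∈ S, (∀ t ∈ S, t ≠ i → f t = 0) → ∑ t ∈ S, f t ≤ d u v := by
    intro i hi h
    rw [sum_eq_single_of_mem i hi h]
    exact hone i
  by_cases hu : ∃ i ∈ S, d (r i) u < 1 / 2
  · obtain ⟨i, hi, hiu⟩ := hu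
    have hnu : ∀ t ∈ S, t ≠ i → 1 / 2 ≤ d (r t) u := fun t ht hti =>
      le_of_not_gt fun h => hti (huniq u t ht i hi h hiu)
    by_cases hv : ∃ j ∈ S, j ≠ i ∧ d (r j) v < 1 / 2
    · obtain ⟨j, hj, hji, hjv⟩ := hv
      have hnv : ∀ t ∈ S, t ≠ j → 1 / 2 ≤ d (r t) v := fun t ht htj =>
        le_of_not_gt fun h => htj (huniq v t ht j hj h hjv)
      rw [sum_eq_add_of_mem i j hi hj hji.symm fun t ht hn =>
        hzero t (hnu t ht hn.1) (hnv t ht hn.2)]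
      have h1 := hsep i hi j hj hji.symm
      have h2 := htri (r i) (r j) u
      have h3 := htri u (r j) v
      rw [hsymm v] at h3
      simp only [hf, min_eq_left hiu.le, min_eq_left hjv.le, min_eq_right (hnu j hj hji),
        min_eq_right (hnv i hi hji.symm)]
      rw [abs_of_neg (by linarith), abs_of_pos (by linarith)]
      linarith
    · push Not at hv
      exact hsingle i hi fun t ht hti => hzero t (hnu t ht hti) (hv t ht hti)
  · push Not at hu
    by_cases hv : ∃ j ∈ S, d (r j) v < 1 / 2
    · obtain ⟨j, hj, hjv⟩ := hv
      exact hsingle j hj fun t ht htj => hzero t (hu t ht) <|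
        le_of_not_gt fun h => htj (huniq v t ht j hj h hjv)
    · push Not at hv
      rw [sum_eq_zero fun t ht => hzero t (hu t ht) (hv t ht)]
      exact h0 u v

theorem card_separating_thresholds_le_abs (N : ℕ) (hN : 0 < N) {x y : ℝ} (hx : 0 ≤ x)
    (hy : 0 ≤ y) :
    (#{m : Fin N | ¬ (x < ((m : ℕ) + 1 : ℝ) / (2 * N) ↔ y < ((m : ℕ) + 1 : ℝ) / (2 * N))} : ℝ) ≤
      2 * N * |min x (1 / 2) - min y (1 / 2)| + 1 := by
  rcases le_total x y with h | h
  · rw [abs_sub_comm]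
    refine (card_separating_thresholds_le N hN x y h hx).trans ?_
    gcongr
    exact le_abs_self _
  · simp_rw [iff_comm (a := x < _)]
    refine (card_separating_thresholds_le N hN y x h hy).trans ?_
    gcongr
    exact le_abs_self _

/-- The points at distance less than `ρ` from `r t`, for each of the metrics `d a` with
`t ∈ S a`. -/
noncomputable def commonBall {V T : Type*} [Fintype V] {k : ℕ} (S : Fin k → Finset T) (r : T → V)
    (d : Fin k → V → V → ℝ) (t : T) (ρ : ℝ) : Finset V :=
  open Classical in univ.filter fun v => ∀ a, t ∈ S a → d a (r t) v < ρ

theorem mem_commonBall {V T : Type*} [Fintype V] {k : ℕ} {S : Fin k → Finset T} {r : T → V}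
    {d : Fin k → V → V → ℝ} {t : T} {ρ : ℝ} {v : V} :
    v ∈ commonBall S r d t ρ ↔ ∀ a, t ∈ S a → d a (r t) v < ρ := by
  simp [commonBall]

/-- The load of the common balls with radii `(m + 1) / (2 * N)`, `m < N`, around all terminals. -/
theorem sum_cutSep_commonBall_le {V T : Type*} [Fintype V] [DecidableEq V] [Fintype T] {k : ℕ}
    (S : Fin k → Finset T) (r : T → V) (d : Fin k → V → V → ℝ)
    (h0 : ∀ a u v, 0 ≤ d a u v) (hsymm : ∀ a u v, d a u v = d a v u)
    (htri : ∀ a u v w, d a u v ≤ d a u w + d a w v)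
    (hsep : ∀ a, ∀ i ∈ S a, ∀ j ∈ S a, i ≠ j → 1 ≤ d a (r i) (r j))
    (N : ℕ) (hN : 0 < N) (u v : V) :
    ((∑ j : T × Fin N, cutSep (commonBall S r d j.1 (((j.2 : ℕ) + 1 : ℝ) / (2 * N))) u v : ℕ) : ℝ) ≤
      2 * N * ∑ a, d a u v + ∑ a, (#(S a) : ℝ) := by
  classical
  set ρ : Fin N → ℝ := fun m => ((m : ℕ) + 1 : ℝ) / (2 * N) with hρ
  have h1 : ∀ (t : T) (m : Fin N), cutSep (commonBall S r d t (ρ m)) u v ≤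
      ∑ a with t ∈ S a, if ¬ (d a (r t) u < ρ m ↔ d a (r t) v < ρ m) then 1 else 0 := by
    intro t m
    by_cases h : ∀ a, t ∈ S a → (d a (r t) u < ρ m ↔ d a (r t) v < ρ m)
    · rw [cutSep, if_pos]
      · exact Nat.zero_le _
      · simp only [mem_commonBall]
        exact forall₂_congr h
    · simp only [not_forall] at h
      obtain ⟨a, ha, h⟩ := h
      refine le_trans ?_ (single_le_sum (fun _ _ => Nat.zero_le _)
        (mem_filter.2 ⟨mem_univ a, ha⟩))
      rw [if_pos h, cutSep]
      split_ifs <;> simp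
  have h2 : ∑ j : T × Fin N, cutSep (commonBall S r d j.1 (ρ j.2)) u v ≤
      ∑ a, ∑ t ∈ S a, #{m : Fin N | ¬ (d a (r t) u < ρ m ↔ d a (r t) v < ρ m)} := by
    rw [Fintype.sum_prod_type]
    refine (sum_le_sum fun t _ => sum_le_sum fun m _ => h1 t m).trans (le_of_eq ?_)
    simp only [card_filter, sum_filter]
    rw [sum_congr rfl fun t _ => sum_comm, sum_comm]
    refine sum_congr rfl fun a _ => ?_
    conv_rhs => rw [← filter_univ_mem (S a), sum_filter]
    refine sum_congr rfl fun t _ => ?_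
    split_ifs <;> simp
  refine (Nat.cast_le.2 h2).trans ?_
  push_cast
  rw [mul_sum, ← sum_add_distrib]
  refine sum_le_sum fun a _ => ?_
  calc ∑ t ∈ S a, (#{m : Fin N | ¬ (d a (r t) u < ρ m ↔ d a (r t) v < ρ m)} : ℝ)
      ≤ ∑ t ∈ S a, (2 * N * |min (d a (r t) u) (1 / 2) - min (d a (r t) v) (1 / 2)| + 1) :=
        sum_le_sum fun t _ => card_separating_thresholds_le_abs N hN (h0 _ _ _) (h0 _ _ _)
    _ = 2 * N * ∑ t ∈ S a, |min (d a (r t) u) (1 / 2) - min (d a (r t) v) (1 / 2)| + #(S a) := by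
        rw [sum_add_distrib, ← mul_sum]
        simp
    _ ≤ 2 * N * d a u v + #(S a) := by
        gcongr
        exact sum_abs_min_dist_sub_le (hsymm a) (htri a) (h0 a) (S a) r (hsep a) u v

end Balls

/-- **Laminarization for multiway cut packing (Lemma `Lam-2`).**
Given a feasible LP solution `d` for an MCP instance with commodities
`S 0, …, S (k-1)`, terminals `T = ⋃ a, S a` located at vertices `r i`
(distinct terminals of the same commodity at distinct vertices), and positive
integer capacities `c`, for every `ε > 0` there is a fractional laminar cut
family for `T` which is feasible for the MCP (for every commodity `a` and
distinct `i, j ∈ S a`, either `r j` lies in no cut of `i`, or `r i` lies in no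
cut of `j`) and whose load on every edge `e` is at most `8 * c e + ε`. -/
theorem mcp_laminarization
    {V T : Type} [Fintype V] [DecidableEq V] [Fintype T] [DecidableEq T]
    (G : SimpleGraph V) [DecidableRel G.Adj]
    (c : Sym2 V → ℕ) (hc : ∀ e ∈ G.edgeSet, 0 < c e)
    (k : ℕ) (S : Fin k → Finset T) (hcover : ∀ i : T, ∃ a, i ∈ S a)
    (r : T → V)
    (hinj : ∀ a, ∀ i ∈ S a, ∀ j ∈ S a, i ≠ j → r i ≠ r j)
    (d : Fin k → V → V → ℝ)
    (hd0 : ∀ a u v, 0 ≤ d a u v) (hd1 : ∀ a u v, d a u v ≤ 1)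
    (hdrefl : ∀ a u, d a u u = 0)
    (hdsymm : ∀ a u v, d a u v = d a v u)
    (hdtri : ∀ a u v w, d a u v ≤ d a u w + d a w v)
    (hsep : ∀ a, ∀ i ∈ S a, ∀ j ∈ S a, i ≠ j → 1 ≤ d a (r i) (r j))
    (hcap : ∀ u v, G.Adj u v → ∑ a, d a u v ≤ (c s(u, v) : ℝ)) :
    ∀ ε : ℝ, 0 < ε →
      ∃ F : FracLaminarFamily V T r,
        (∀ a, ∀ i ∈ S a, ∀ j ∈ S a, i ≠ j →
          (∀ jc, F.owner jc = i → r j ∉ F.cut jc) ∨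
          (∀ jc, F.owner jc = j → r i ∉ F.cut jc)) ∧
        (∀ u v, G.Adj u v →
          F.load u v ≤ 8 * (c s(u, v) : ℝ) + ε) := by
  intro ε hε
  obtain ⟨K, hK⟩ : ∃ K : ℝ, K = ∑ a, (#(S a) : ℝ) := ⟨_, rfl⟩
  obtain ⟨N, hN⟩ : ∃ N : ℕ, 4 * (Fintype.card T : ℝ) + 4 * K / ε + 1 ≤ N := exists_nat_ge _
  have hK0 : 0 ≤ K := hK ▸ sum_nonneg fun _ _ => Nat.cast_nonneg _
  have hKε : 0 ≤ 4 * K / ε := div_nonneg (mul_nonneg zero_le_four hK0) hε.le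
  have hN1 : (1 : ℝ) ≤ N := by
    have : (0 : ℝ) ≤ Fintype.card T := Nat.cast_nonneg _
    linarith
  have hN0 : 0 < N := by exact_mod_cast hN1
  have hN0' : (0 : ℝ) < N := by exact_mod_cast hN0
  have hNT : 4 * Fintype.card T ≤ N := by
    have : 4 * (Fintype.card T : ℝ) ≤ N := by linarith
    exact_mod_cast this
  have hNK : 4 * K / N ≤ ε := by
    rw [div_le_iff₀ hN0', ← div_le_iff₀' hε]
    have : (0 : ℝ) ≤ Fintype.card T := Nat.cast_nonneg _
    linarith
  let ρ : Fin N → ℝ := fun m => ((m : ℕ) + 1 : ℝ) / (2 * N)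
  have hρ0 : ∀ m, 0 < ρ m := fun m => by
    change (0 : ℝ) < ((m : ℕ) + 1 : ℝ) / (2 * N)
    positivity
  have hρ1 : ∀ m, ρ m ≤ 1 / 2 := fun m => by
    change ((m : ℕ) + 1 : ℝ) / (2 * N) ≤ 1 / 2
    rw [div_le_iff₀ (by positivity)]
    have : ((m : ℕ) + 1 : ℝ) ≤ N := by exact_mod_cast m.2
    linarith
  obtain ⟨F, Y, hroot, hlam, hasymm, hload, hbal⟩ := exists_laminar_half
    (J := T × Fin N) (r := fun j => r j.1) (τ := Prod.fst)
    (con := fun i j => ∃ a, i.1 ∈ S a ∧ j.1 ∈ S a ∧ i.1 ≠ j.1)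
    (fun i j ⟨a, hi, hj, hij⟩ => ⟨a, hj, hi, hij.symm⟩) (fun i j hij => congrArg r hij)
    (fun j => commonBall S r d j.1 (ρ j.2))
    (fun j => mem_commonBall.2 fun a _ => (hdrefl a _).trans_lt (hρ0 _))
    (by
      rintro i j ⟨a, hi, hj, hij⟩
      refine disjoint_left.2 fun v hvi hvj => ?_
      have h1 := mem_commonBall.1 hvi a hi
      have h2 := mem_commonBall.1 hvj a hj
      have h3 := hsep a _ hi _ hj hij
      have h4 := hdtri a (r i.1) (r j.1) v
      have h5 := hρ1 i.2
      have h6 := hρ1 j.2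
      rw [hdsymm a v] at h4
      linarith)
  have hkept : ∀ t, (N : ℝ) / 4 ≤ #{j ∈ F | j.1 = t} := by
    intro t
    have hcard : #{j : T × Fin N | j.1 = t} = N := by
      have : ({j : T × Fin N | j.1 = t} : Finset _) = {t} ×ˢ univ := by
        ext ⟨x, m⟩
        simp [eq_comm]
      rw [this, card_product, card_singleton, card_univ, Fintype.card_fin, one_mul]
    have h1 := (single_le_sum (fun t _ => sq_nonneg
      (2 * #{j ∈ F | j.1 = t} - #{j : T × Fin N | j.1 = t} : ℤ)) (mem_univ t)).trans hbal
    rw [hcard, Fintype.card_prod, Fintype.card_fin] at h1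
    have h2 : (2 * #{j ∈ F | j.1 = t} - N : ℝ) ^ 2 ≤ Fintype.card T * N := by exact_mod_cast h1
    have h3 : (Fintype.card T : ℝ) * N ≤ (N / 2 : ℝ) ^ 2 := by
      have : 4 * (Fintype.card T : ℝ) ≤ N := by exact_mod_cast hNT
      nlinarith
    have h4 := (abs_le.1 (abs_le_of_sq_le_sq (h2.trans h3) (by positivity))).1
    linarith
  have hkept0 : ∀ t, (0 : ℝ) < #{j ∈ F | j.1 = t} := fun t =>
    (by positivity : (0 : ℝ) < N / 4).trans_le (hkept t)
  have hsum : ∀ f : T × Fin N → ℝ, ∑ j, f (F.equivFin.symm j) = ∑ j ∈ F, f j := fun f => by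
    rw [Equiv.sum_comp F.equivFin.symm (fun j : F => f j), sum_coe_sort]
  refine ⟨{
    n := #F
    cut := fun j => Y (F.equivFin.symm j)
    wt := fun j => 1 / #{i ∈ F | i.1 = (F.equivFin.symm j : T × Fin N).1}
    owner := fun j => (F.equivFin.symm j : T × Fin N).1
    wt_pos := fun j => one_div_pos.2 (hkept0 _)
    laminar := fun j j' => hlam _ (F.equivFin.symm j).2 _ (F.equivFin.symm j').2
    root_mem := fun j => hroot _
    wt_sum := fun t => ?_ }, fun a i hi j hj hij => ?_, fun u v huv => ?_⟩
  · rw [sum_filter, hsum fun x => if x.1 = t then (1 : ℝ) / #{i ∈ F | i.1 = x.1} else 0,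
      ← sum_filter, sum_congr rfl fun x hx => by rw [(mem_filter.1 hx).2], sum_const, nsmul_eq_mul,
      mul_one_div_cancel (hkept0 t).ne']
  · by_contra! hc
    obtain ⟨⟨j₁, hj₁, hm₁⟩, j₂, hj₂, hm₂⟩ := hc
    subst hj₁ hj₂
    exact hasymm _ (F.equivFin.symm j₁).2 _ (F.equivFin.symm j₂).2 ⟨a, hi, hj, hij⟩ ⟨hm₁, hm₂⟩
  · have h1 := sum_cutSep_commonBall_le S r d hd0 hdsymm hdtri hsep N hN0 u v
    rw [← hK] at h1
    have h2 : ((∑ j ∈ F, cutSep (Y j) u v : ℕ) : ℝ) ≤ 2 * N * ∑ a, d a u v + K :=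
      (Nat.cast_le.2 (hload u v)).trans h1
    rw [FracLaminarFamily.load, hsum fun x => if ¬ (u ∈ Y x ↔ v ∈ Y x) then
      (1 : ℝ) / #{i ∈ F | i.1 = x.1} else 0]
    calc ∑ x ∈ F, (if ¬ (u ∈ Y x ↔ v ∈ Y x) then (1 : ℝ) / #{i ∈ F | i.1 = x.1} else 0)
        ≤ ∑ x ∈ F, 4 / N * (cutSep (Y x) u v : ℝ) := by
          refine sum_le_sum fun x _ => ?_
          have h3 : (1 : ℝ) / #{i ∈ F | i.1 = x.1} ≤ 4 / N := by
            rw [div_le_div_iff₀ (hkept0 _) hN0']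
            linarith [hkept x.1]
          by_cases h : u ∈ Y x ↔ v ∈ Y x
          · simp [cutSep, h]
          · simpa [cutSep, h] using h3
      _ = 4 / N * ((∑ j ∈ F, cutSep (Y j) u v : ℕ) : ℝ) := by
          push_cast
          rw [mul_sum]
      _ ≤ 4 / N * (2 * N * ∑ a, d a u v + K) := by gcongr
      _ = 8 * ∑ a, d a u v + 4 * K / N := by field_simp; ring
      _ ≤ 8 * (c s(u, v) : ℝ) + ε := by
          have := hcap u v huv
          linarith
end

section
/- Let G=(V,E) be a finite simple undirected graph with positive integer edge capacities c_e, a sink vertex t, and source terminals at vertices r_1,…,r_k with r_a ≠ t. Suppose there exists a fractional laminar cut family for the terminals {1,…,k} such that no cut in the family contains t and whose load on every edge e is at most c_e. Then there exist subsets A_1,…,A_k ⊆ V with r_a ∈ A_a and t ∉ A_a for every a, such that every edge e belongs to δ(A_a) for at most c_e + 1 indices a. -/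
open Finset

/-- The state of a greedy rounding after the cuts indexed by `s` have been processed. The map `A`
assigns to some terminals a processed cut containing them, and `b v` is the amount of cut weight
around `v` that has already been paid for in advance by assigned terminals. -/
structure IsPartialRounding {V T ι : Type*} [DecidableEq V] [Fintype T]
    [Fintype ι] [DecidableEq ι] (cut : ι → Finset V) (wt : ι → ℝ) (r : T → V)
    (s : Finset ι) (A : T → Option ι) (b : V → ℝ) : Prop where
  mem : ∀ a i, A a = some i → i ∈ s ∧ r a ∈ cut i
  nonneg : ∀ v, 0 ≤ b v
  lt_one : ∀ v, b v < 1
  load_le : ∀ u, (#{a | ∃ i, A a = some i ∧ u ∈ cut i} : ℝ) ≤ ∑ i ∈ s with u ∈ cut i, wt i + b u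
  crossing_lt : ∀ u v, (#{a | ∃ i, A a = some i ∧ u ∈ cut i ∧ v ∉ cut i} : ℝ)
    < ∑ i ∈ s with u ∈ cut i ∧ v ∉ cut i, wt i + 1
  supply_le : ∀ U : Finset V, (∀ i ∈ s, cut i ⊆ U ∨ Disjoint (cut i) U) → ∀ v ∈ U,
    ∑ i ∈ s with cut i ⊆ U, wt i + b v ≤ #{a | r a ∈ U ∧ A a ≠ none}

theorem card_filter_assign {T ι : Type*} [Fintype T] [DecidableEq T] [Fintype ι] [DecidableEq ι]
    {A : T → Option ι} {Y : Finset T} (hY : ∀ a ∈ Y, A a = none) (j : ι)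
    (P : ι → Prop) [DecidablePred P] :
    #{a | ∃ i, (if a ∈ Y then some j else A a) = some i ∧ P i}
      = #{a | ∃ i, A a = some i ∧ P i} + if P j then #Y else 0 := by
  split_ifs with hj
  · rw [← card_union_of_disjoint]
    · congr 1
      ext a
      by_cases ha : a ∈ Y <;> simp [ha, hj]
    · rw [disjoint_right]
      intro a ha
      simp [hY a ha]
  · rw [add_zero]
    congr 1
    ext a
    by_cases ha : a ∈ Y
    · simp [ha, hj, hY a ha]
    · simp [ha]

theorem sum_filter_insert_ite {ι : Type*} [DecidableEq ι] {s : Finset ι} {j : ι} (hj : j ∉ s)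
    (wt : ι → ℝ) (P : ι → Prop) [DecidablePred P] :
    ∑ i ∈ insert j s with P i, wt i = ∑ i ∈ s with P i, wt i + if P j then wt j else 0 := by
  rw [sum_filter, sum_filter, sum_insert hj, add_comm]

/-- One step of the greedy rounding: with blocked length `β`, cut weight `x` and `g` waiting
terminals, `y` of the terminals can be assigned to the cut so that less than one unit of weight
is paid for in advance. -/
theorem exists_greedy_step (β x : ℝ) (hβ : β < 1) (hx : 0 ≤ x) (g : ℕ) :
    ∃ y ≤ g, ∃ β' : ℝ, 0 ≤ β' ∧ β' < 1 ∧ β + y - x ≤ β' ∧ (β' = β + y - x ∨ y = g ∧ β' = 0) := by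
  refine ⟨min g ⌈x - β⌉₊, min_le_left _ _, max 0 (β + (min g ⌈x - β⌉₊ : ℕ) - x),
    le_max_left _ _, max_lt one_pos ?_, le_max_right _ _, ?_⟩
  · have h : ((min g ⌈x - β⌉₊ : ℕ) : ℝ) ≤ (⌈x - β⌉₊ : ℝ) := by exact_mod_cast min_le_right _ _
    rcases le_total (x - β) 0 with h0 | h0
    · rw [Nat.ceil_eq_zero.2 h0] at h ⊢
      simp only [Nat.zero_le, inf_of_le_right, Nat.cast_zero]
      linarith
    · linarith [Nat.ceil_lt_add_one h0]
  · rcases le_total g ⌈x - β⌉₊ with h | h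
    · rw [min_eq_left h]
      rcases le_total 0 (β + (g : ℝ) - x) with h' | h'
      · exact .inl (max_eq_right h')
      · exact .inr ⟨rfl, max_eq_left h'⟩
    · rw [min_eq_right h]
      exact .inl (max_eq_right (by linarith [Nat.le_ceil (x - β)]))

/-- A partial rounding extends to a further cut that is at least as large as all earlier ones. -/
theorem IsPartialRounding.exists_insert {V T ι : Type*} [DecidableEq V] [Fintype T] [DecidableEq T]
    [Fintype ι] [DecidableEq ι] {cut : ι → Finset V} {wt : ι → ℝ}
    {r : T → V} {s : Finset ι} {A : T → Option ι} {b : V → ℝ} (h : IsPartialRounding cut wt r s A b)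
    {j : ι} (hj : j ∉ s) (hwt : 0 ≤ wt j) (hne : ∀ i, (cut i).Nonempty)
    (hsub : ∀ i ∈ s, cut i ⊆ cut j ∨ Disjoint (cut i) (cut j))
    (hcap : ∑ i ∈ insert j s with cut i ⊆ cut j, wt i ≤ #{a | r a ∈ cut j}) :
    ∃ A' b', IsPartialRounding cut wt r (insert j s) A' b' := by
  obtain ⟨w, hw, hmax⟩ := exists_max_image (cut j) b (hne j)
  set W : Finset T := {a | r a ∈ cut j ∧ A a = none} with hW
  obtain ⟨y, hy, β, hβ0, hβ1, hle, hβ⟩ := exists_greedy_step (b w) (wt j) (h.lt_one w) hwt #W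
  obtain ⟨Y, hYW, rfl⟩ := exists_subset_card_eq hy
  have hYr : ∀ a ∈ Y, r a ∈ cut j := fun a ha => (mem_filter.1 (hYW ha)).2.1
  have hY : ∀ a ∈ Y, A a = none := fun a ha => (mem_filter.1 (hYW ha)).2.2
  have hsplit : #{a | r a ∈ cut j} = #{a | r a ∈ cut j ∧ A a ≠ none} + #W := by
    rw [hW, ← filter_filter, ← filter_filter, add_comm, card_filter_add_card_filter_not]
  have hpaid : ∑ i ∈ s with cut i ⊆ cut j, wt i + wt j + β
      ≤ #{a | r a ∈ cut j ∧ A a ≠ none} + #Y := by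
    rcases hβ with rfl | ⟨hyg, rfl⟩
    · linarith [h.supply_le (cut j) hsub w hw]
    · rw [sum_filter_insert_ite hj, if_pos Subset.rfl, hsplit] at hcap
      rw [hyg]
      push_cast at hcap
      linarith
  have hload : ∀ u ∈ cut j, (#{a | ∃ i, A a = some i ∧ u ∈ cut i} : ℝ) + #Y
      ≤ ∑ i ∈ s with u ∈ cut i, wt i + wt j + β := fun u hu => by
    linarith [h.load_le u, hmax u hu]
  refine ⟨fun a => if a ∈ Y then some j else A a, fun v => if v ∈ cut j then β else b v,
    ?_, ?_, ?_, ?_, ?_, ?_⟩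
  · intro a i hi
    by_cases ha : a ∈ Y
    · simp only [ha, if_true, Option.some.injEq] at hi
      subst hi
      exact ⟨mem_insert_self _ _, hYr a ha⟩
    · simp only [ha, if_false] at hi
      exact ⟨mem_insert_of_mem (h.mem a i hi).1, (h.mem a i hi).2⟩
  · intro v
    split_ifs
    exacts [hβ0, h.nonneg v]
  · intro v
    split_ifs
    exacts [hβ1, h.lt_one v]
  · intro u
    rw [card_filter_assign hY, sum_filter_insert_ite hj]
    split_ifs with hu
    · push_cast
      exact hload u hu
    · simpa using h.load_le u
  · intro u v
    rw [card_filter_assign hY j fun i => u ∈ cut i ∧ v ∉ cut i, sum_filter_insert_ite hj]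
    split_ifs with huv
    · have key : ∀ i ∈ s, u ∈ cut i → v ∉ cut i := fun i hi hu hv => by
        rcases hsub i hi with h' | h'
        · exact huv.2 (h' hv)
        · exact disjoint_left.1 h' hu huv.1
      have h1 : #{a | ∃ i, A a = some i ∧ u ∈ cut i ∧ v ∉ cut i}
          = #{a | ∃ i, A a = some i ∧ u ∈ cut i} := by
        congr 1
        refine filter_congr fun a _ => exists_congr fun i => and_congr_right fun hi => ?_
        exact and_iff_left_of_imp (key i (h.mem a i hi).1)
      have h2 : s.filter (fun i => u ∈ cut i ∧ v ∉ cut i) = s.filter fun i => u ∈ cut i :=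
        filter_congr fun i hi => and_iff_left_of_imp (key i hi)
      rw [h1, h2]
      push_cast
      linarith [hload u huv.1]
    · simpa using h.crossing_lt u v
  · intro U hU v hv
    have hUs : ∀ i ∈ s, cut i ⊆ U ∨ Disjoint (cut i) U := fun i hi => hU i (mem_insert_of_mem hi)
    rw [sum_filter_insert_ite hj]
    rcases hU j (mem_insert_self _ _) with hjU | hjU
    · rw [if_pos hjU]
      have hcard : #{a | r a ∈ U ∧ (if a ∈ Y then some j else A a) ≠ none}
          = #{a | r a ∈ U \ cut j ∧ A a ≠ none}
            + (#{a | r a ∈ cut j ∧ A a ≠ none} + #Y) := by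
        rw [← card_union_of_disjoint, ← card_union_of_disjoint]
        · congr 1
          ext a
          by_cases ha : a ∈ Y
          · simp [ha, hjU (hYr a ha)]
          · by_cases hra : r a ∈ cut j
            · simp [ha, hra, hjU hra]
            · simp [ha, hra]
        · rw [disjoint_left]
          intro a ha
          simp only [mem_filter, mem_univ, true_and, mem_sdiff, mem_union] at ha ⊢
          rintro (h' | h')
          exacts [ha.1.2 h'.1, ha.2 (hY a h')]
        · rw [disjoint_right]
          intro a ha
          simp [hY a ha]
      have hsum : ∑ i ∈ s with cut i ⊆ U, wt i
          = ∑ i ∈ s with cut i ⊆ U \ cut j, wt i + ∑ i ∈ s with cut i ⊆ cut j, wt i := by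
        rw [← sum_union]
        · congr 1
          ext i
          simp only [mem_filter, mem_union, subset_sdiff]
          refine ⟨fun ⟨hi, hiU⟩ => ?_, ?_⟩
          · rcases hsub i hi with h' | h'
            exacts [.inr ⟨hi, h'⟩, .inl ⟨hi, hiU, h'⟩]
          · rintro (⟨hi, hiU, -⟩ | ⟨hi, h'⟩)
            exacts [⟨hi, hiU⟩, ⟨hi, h'.trans hjU⟩]
        · rw [disjoint_left]
          intro i hi hi'
          simp only [mem_filter, subset_sdiff] at hi hi'
          obtain ⟨z, hz⟩ := hne i
          exact disjoint_left.1 hi.2.2 hz (hi'.2 hz)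
      have hdiff : ∀ i ∈ s, cut i ⊆ U \ cut j ∨ Disjoint (cut i) (U \ cut j) := fun i hi => by
        rcases hsub i hi with h' | h'
        · exact .inr (disjoint_sdiff.mono_left h')
        · rcases hUs i hi with h'' | h''
          · exact .inl (subset_sdiff.2 ⟨h'', h'⟩)
          · exact .inr (h''.mono_right sdiff_subset)
      rw [hcard, hsum]
      push_cast
      by_cases hvj : v ∈ cut j
      · rw [if_pos hvj]
        have hrest : ∑ i ∈ s with cut i ⊆ U \ cut j, wt i
            ≤ #{a | r a ∈ U \ cut j ∧ A a ≠ none} := by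
          rcases (U \ cut j).eq_empty_or_nonempty with he | ⟨z, hz⟩
          · rw [he, filter_false_of_mem fun i _ hi => (hne i).ne_empty (subset_empty.1 hi)]
            simp
          · linarith [h.supply_le _ hdiff z hz, h.nonneg z]
        linarith
      · rw [if_neg hvj]
        linarith [h.supply_le _ hdiff v (mem_sdiff.2 ⟨hv, hvj⟩)]
    · have hvj : v ∉ cut j := fun hvj => disjoint_left.1 hjU hvj hv
      have hjU' : ¬cut j ⊆ U := fun h' => by
        obtain ⟨z, hz⟩ := hne j
        exact disjoint_left.1 hjU hz (h' hz)
      rw [if_neg hjU', if_neg hvj, add_zero]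
      refine (h.supply_le U hUs v hv).trans ?_
      refine Nat.cast_le.2 (card_le_card (monotone_filter_right _ fun a _ ha => ⟨ha.1, ?_⟩))
      split_ifs
      · simp
      · exact ha.2

/-- A laminar family admits a partial rounding that processes all of its cuts, provided that the cuts
contained in any given member weigh at most as much as the number of terminals in it. -/
theorem exists_isPartialRounding {V T ι : Type*} [DecidableEq V] [Fintype T] [DecidableEq T]
    [Fintype ι] [DecidableEq ι] {cut : ι → Finset V} {wt : ι → ℝ}
    {r : T → V}
    (hwt : ∀ i, 0 ≤ wt i) (hne : ∀ i, (cut i).Nonempty)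
    (hlam : ∀ i j, ¬Disjoint (cut i) (cut j) → cut i ⊆ cut j ∨ cut j ⊆ cut i)
    (hcap : ∀ j, ∑ i with cut i ⊆ cut j, wt i ≤ #{a | r a ∈ cut j}) :
    ∃ A b, IsPartialRounding cut wt r univ A b := by
  refine induction_on_max_value (fun i => #(cut i)) univ ?_ ?_
  · exact ⟨fun _ => none, fun _ => 0, by simp, by simp, by simp, by simp, by simp, by simp⟩
  · rintro j s hj hmax ⟨A, b, h⟩
    refine h.exists_insert hj (hwt j) hne (fun i hi => ?_) ((sum_le_sum_of_subset_of_nonneg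
      (filter_subset_filter _ (subset_univ _)) fun i _ _ => hwt i).trans (hcap j))
    by_cases hd : Disjoint (cut i) (cut j)
    · exact .inr hd
    · rcases hlam i j hd with h' | h'
      exacts [.inl h', .inl (eq_of_subset_of_card_le h' (hmax i hi)).ge]

theorem FracLaminarFamily.sum_wt_le {V T : Type} [DecidableEq V] [Fintype T] [DecidableEq T]
    {r : T → V} (F : FracLaminarFamily V T r) (U : Finset V) :
    ∑ j with F.cut j ⊆ U, F.wt j ≤ #{a | r a ∈ U} := by
  calc ∑ j with F.cut j ⊆ U, F.wt j
      ≤ ∑ j with F.owner j ∈ ({a | r a ∈ U} : Finset T), F.wt j :=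
        sum_le_sum_of_subset_of_nonneg
          (monotone_filter_right _ fun j _ hj => by simpa using hj (F.root_mem j))
          fun j _ _ => (F.wt_pos j).le
    _ = ∑ a with r a ∈ U, ∑ j with F.owner j = a, F.wt j := by
        rw [sum_fiberwise_eq_sum_filter]
    _ = #{a | r a ∈ U} := by simp [F.wt_sum]

/-- **Rounding for the common-sink case (Lemma `Round-1`).**
If a CSCP instance (sink `t`, sources `r 0, …, r (k-1)`, positive integer
capacities `c`) admits a fractional laminar cut family all of whose cuts avoid
`t` and whose load on every edge is at most the edge's capacity, then there
are integral cuts `A a ∋ r a` with `t ∉ A a` such that every edge `{u,v}`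
crosses at most `c {u,v} + 1` of the cuts `δ(A a)`. -/
theorem cscp_rounding
    {V : Type} [Fintype V] [DecidableEq V]
    (G : SimpleGraph V) [DecidableRel G.Adj]
    (c : Sym2 V → ℕ) (hc : ∀ e ∈ G.edgeSet, 0 < c e)
    (t : V) (k : ℕ) (r : Fin k → V) (hrt : ∀ a, r a ≠ t)
    (F : FracLaminarFamily V (Fin k) r)
    (hFt : ∀ j, t ∉ F.cut j)
    (hFload : ∀ u v, G.Adj u v → F.load u v ≤ (c s(u, v) : ℝ)) :
    ∃ A : Fin k → Finset V,
      (∀ a, r a ∈ A a ∧ t ∉ A a) ∧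
      (∀ u v, G.Adj u v →
        (univ.filter fun a => ¬((u ∈ A a) ↔ (v ∈ A a))).card
          ≤ c s(u, v) + 1) := by
  obtain ⟨A, b, h⟩ := exists_isPartialRounding (cut := F.cut) (wt := F.wt) (r := r)
    (fun j => (F.wt_pos j).le) (fun j => ⟨_, F.root_mem j⟩)
    (fun i j hij => F.laminar i j (not_disjoint_iff_nonempty_inter.1 hij))
    (fun j => F.sum_wt_le (F.cut j))
  have htotal : ∑ j, F.wt j = k := by
    rw [← sum_fiberwise univ F.owner]
    simp [F.wt_sum]
  have hall : ∀ a, A a ≠ none := by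
    have hsupply := h.supply_le univ (by simp) t (mem_univ t)
    simp only [subset_univ, filter_true, mem_univ, true_and, htotal] at hsupply
    have hcard : k ≤ #{a | A a ≠ none} := by
      have : (k : ℝ) ≤ #{a | A a ≠ none} := by
        convert (le_add_of_nonneg_right (h.nonneg t)).trans hsupply
      exact_mod_cast this
    have huniv := (card_eq_iff_eq_univ _).1
      ((card_le_univ _).antisymm (by rwa [Fintype.card_fin]) :
        #{a | A a ≠ none} = Fintype.card (Fin k))
    intro a
    have ha : a ∈ ({a | A a ≠ none} : Finset (Fin k)) := by
      rw [huniv]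
      exact mem_univ a
    exact (mem_filter.1 ha).2
  choose f hf using fun a => Option.ne_none_iff_exists'.1 (hall a)
  refine ⟨fun a => F.cut (f a), fun a => ⟨(h.mem a _ (hf a)).2, hFt _⟩, fun u v huv => ?_⟩
  have hone : ∀ u v, (#{a | u ∈ F.cut (f a) ∧ v ∉ F.cut (f a)} : ℝ)
      < ∑ j with u ∈ F.cut j ∧ v ∉ F.cut j, F.wt j + 1 := fun u v => by
    convert h.crossing_lt u v using 4
    simp [hf]
  have hload : F.load u v = ∑ j with u ∈ F.cut j ∧ v ∉ F.cut j, F.wt j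
      + ∑ j with v ∈ F.cut j ∧ u ∉ F.cut j, F.wt j := by
    rw [FracLaminarFamily.load, sum_filter, sum_filter, ← sum_add_distrib]
    refine sum_congr rfl fun j _ => ?_
    by_cases hu : u ∈ F.cut j <;> by_cases hv : v ∈ F.cut j <;> simp [hu, hv]
  have hcount : #{a | ¬(u ∈ F.cut (f a) ↔ v ∈ F.cut (f a))}
      ≤ #{a | u ∈ F.cut (f a) ∧ v ∉ F.cut (f a)} + #{a | v ∈ F.cut (f a) ∧ u ∉ F.cut (f a)} := by
    refine (card_le_card fun a ha => ?_).trans (card_union_le _ _)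
    simp only [mem_filter, mem_univ, true_and, mem_union] at ha ⊢
    tauto
  have hlt : (#{a | u ∈ F.cut (f a) ∧ v ∉ F.cut (f a)}
      + #{a | v ∈ F.cut (f a) ∧ u ∉ F.cut (f a)} : ℝ) < c s(u, v) + 2 := by
    linarith [hone u v, hone v u, hFload u v huv]
  have hlt' : #{a | u ∈ F.cut (f a) ∧ v ∉ F.cut (f a)}
      + #{a | v ∈ F.cut (f a) ∧ u ∉ F.cut (f a)} < c s(u, v) + 2 := by exact_mod_cast hlt
  exact hcount.trans (by omega)
end

section
/- Let G=(V,E) be a finite simple undirected graph with positive integer edge capacities c_e and commodities S_1,…,S_k (finite sets of terminals, terminal i located at vertex r_i, distinct terminals of the same commodity at distinct vertices). Suppose there exists a fractional laminar cut family for the terminal set T = ∪_a S_a such that for every commodity a and all distinct i,j ∈ S_a, either r_j belongs to no cut of C_i or r_i belongs to no cut of C_j, and whose load on every edge e is at most c_e. Then there exist subsets A_i ⊆ V, one per terminal i ∈ T, with r_i ∈ A_i for every i, such that for every commodity a and all distinct i,j ∈ S_a either r_j ∉ A_i or r_i ∉ A_j, and every edge e belongs to δ(A_i) for at most c_e + 3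 terminals i. -/
open Finset

/-- A fractional matching saturating the finite left side, with column sums at most `1`, has an
injective choice function within its support. -/
theorem exists_injective_of_fractional_matching {T α : Type} [Fintype T] [DecidableEq T]
    [Fintype α] [DecidableEq α] (x : T → α → ℝ) (hx : ∀ i a, 0 ≤ x i a)
    (hrow : ∀ i, ∑ a, x i a = 1) (hcol : ∀ a, ∑ i, x i a ≤ 1) :
    ∃ f : T → α, Function.Injective f ∧ ∀ i, x i (f i) ≠ 0 := by
  classical
  have hall := (Finset.all_card_le_biUnion_card_iff_exists_injective
    (fun i => univ.filter fun a => x i a ≠ 0)).1 (fun I => by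
      set N := I.biUnion fun i => univ.filter fun a => x i a ≠ 0 with hN
      have hI : ∀ i ∈ I, ∑ a ∈ N, x i a = 1 := by
        intro i hi
        rw [← hrow i]
        refine Finset.sum_subset (Finset.subset_univ _) fun a _ ha => ?_
        by_contra hne
        exact ha (Finset.mem_biUnion.2 ⟨i, hi, by simpa using hne⟩)
      have hle : (I.card : ℝ) ≤ N.card := by
        calc (I.card : ℝ) = ∑ i ∈ I, ∑ a ∈ N, x i a := by
              rw [Finset.sum_congr rfl hI]; simp
          _ = ∑ a ∈ N, ∑ i ∈ I, x i a := Finset.sum_comm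
          _ ≤ ∑ a ∈ N, (1 : ℝ) := by
              refine Finset.sum_le_sum fun a _ => le_trans ?_ (hcol a)
              exact Finset.sum_le_sum_of_subset_of_nonneg (Finset.subset_univ _)
                fun i _ _ => hx i a
          _ = N.card := by simp
      exact_mod_cast hle)
  obtain ⟨f, hf, hmem⟩ := hall
  exact ⟨f, hf, fun i => by simpa using hmem i⟩

/-- Telescoping along the partial sums of `w` over a finite set in a linear order. -/
theorem sum_partial_sums_telescope {ι : Type} [LinearOrder ι] (w : ι → ℝ) (g : ℝ → ℝ)
    (s : Finset ι) :
    ∑ j ∈ s, (g (∑ l ∈ s with l ≤ j, w l) - g (∑ l ∈ s with l ≤ j, w l - w j))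
      = g (∑ l ∈ s, w l) - g 0 := by
  induction s using Finset.induction_on_max with
  | empty => simp
  | insert a s ha ih =>
    have hna : a ∉ s := fun h => lt_irrefl _ (ha a h)
    have h1 : (insert a s).filter (· ≤ a) = insert a s :=
      Finset.filter_true_of_mem fun x hx => by
        rcases Finset.mem_insert.1 hx with rfl | hx
        exacts [le_rfl, (ha x hx).le]
    have h2 : ∀ j ∈ s, (insert a s).filter (· ≤ j) = s.filter (· ≤ j) := fun j hj => by
      rw [Finset.filter_insert, if_neg (not_le.2 (ha j hj))]
    have h3 : ∑ j ∈ s, (g (∑ l ∈ insert a s with l ≤ j, w l) -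
        g (∑ l ∈ insert a s with l ≤ j, w l - w j)) = g (∑ l ∈ s, w l) - g 0 :=
      (Finset.sum_congr rfl fun j hj => by rw [h2 j hj]).trans ih
    rw [Finset.sum_insert hna, h1, h3, Finset.sum_insert hna, add_sub_cancel_left,
      sub_add_sub_cancel]

namespace FracLaminarFamily

variable {V T : Type} [DecidableEq V] [Fintype T] [DecidableEq T] {r : T → V}

/-- The total weight of the cuts containing `X`. -/
noncomputable def depth (F : FracLaminarFamily V T r) (X : Finset V) : ℝ :=
  ∑ l with X ⊆ F.cut l, F.wt l

/-- The total weight of the cuts containing `cut j` and not listed after `j`. -/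
noncomputable def level (F : FracLaminarFamily V T r) (j : Fin F.n) : ℝ :=
  ∑ l with F.cut j ⊆ F.cut l ∧ l ≤ j, F.wt l

/-- The cuts are listed by decreasing size. -/
def Sorted (F : FracLaminarFamily V T r) : Prop :=
  ∀ j l, j ≤ l → (F.cut l).card ≤ (F.cut j).card

/-- The part of `[0, x]` lying between the integer parts of the two ends of the interval of
length `wt j` that ends at `level j`. -/
noncomputable def slot (F : FracLaminarFamily V T r) (j : Fin F.n) (x : ℝ) : ℝ :=
  min x ⌊F.level j⌋ - min x ⌊F.level j - F.wt j⌋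

variable (F : FracLaminarFamily V T r)

theorem wt_le_one (j : Fin F.n) : F.wt j ≤ 1 := by
  rw [← F.wt_sum (F.owner j)]
  exact Finset.single_le_sum (f := F.wt) (fun l _ => (F.wt_pos l).le) (by simp)

theorem wt_le_level (j : Fin F.n) : F.wt j ≤ F.level j :=
  Finset.single_le_sum (f := F.wt) (fun l _ => (F.wt_pos l).le) (by simp)

theorem level_sub_nonneg (j : Fin F.n) : 0 ≤ F.level j - F.wt j :=
  sub_nonneg.2 (F.wt_le_level j)

theorem level_nonneg (j : Fin F.n) : 0 ≤ F.level j :=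
  (F.wt_pos j).le.trans (F.wt_le_level j)

theorem floor_level_sub_le (j : Fin F.n) : ⌊F.level j - F.wt j⌋ ≤ ⌊F.level j⌋ :=
  Int.floor_le_floor (by linarith [F.wt_pos j])

theorem floor_level_le (j : Fin F.n) : ⌊F.level j⌋ ≤ ⌊F.level j - F.wt j⌋ + 1 := by
  rw [← Int.floor_add_one]
  exact Int.floor_le_floor (by linarith [F.wt_le_one j])

theorem depth_nonneg (X : Finset V) : 0 ≤ F.depth X :=
  Finset.sum_nonneg fun l _ => (F.wt_pos l).le

variable {F}

theorem Sorted.cut_subset (hF : F.Sorted) {j l : Fin F.n} (h : l ≤ j)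
    (hne : (F.cut j ∩ F.cut l).Nonempty) : F.cut j ⊆ F.cut l := by
  rcases F.laminar j l hne with h' | h'
  · exact h'
  · exact (Finset.eq_of_subset_of_card_le h' (hF l j h)).symm.subset

theorem Sorted.level_eq (hF : F.Sorted) {X : Finset V} (hX : X.Nonempty) {j : Fin F.n}
    (hj : X ⊆ F.cut j) : F.level j = ∑ l ∈ univ.filter (fun l => X ⊆ F.cut l) with l ≤ j, F.wt l := by
  rw [level, Finset.filter_filter]
  congr 1
  ext l
  simp only [Finset.mem_filter, Finset.mem_univ, true_and]
  refine ⟨fun h => ⟨hj.trans h.1, h.2⟩, fun h => ⟨hF.cut_subset h.2 ?_, h.2⟩⟩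
  exact hX.mono (Finset.subset_inter hj h.1)

theorem Sorted.telescope (hF : F.Sorted) {X : Finset V} (hX : X.Nonempty) (g : ℝ → ℝ) :
    ∑ j with X ⊆ F.cut j, (g (F.level j) - g (F.level j - F.wt j)) = g (F.depth X) - g 0 := by
  rw [depth, ← sum_partial_sums_telescope]
  refine Finset.sum_congr rfl fun j hj => ?_
  rw [hF.level_eq hX (Finset.mem_filter.1 hj).2]

theorem Sorted.level_le (hF : F.Sorted) {j l : Fin F.n} (h : j < l)
    (hne : (F.cut l ∩ F.cut j).Nonempty) : F.level j ≤ F.level l - F.wt l := by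
  have hsub := hF.cut_subset h.le hne
  have hl : l ∈ univ.filter fun m => F.cut l ⊆ F.cut m ∧ m ≤ l := by simp
  rw [level, level, ← Finset.sum_erase_eq_sub hl]
  refine Finset.sum_le_sum_of_subset_of_nonneg (fun m hm => ?_) fun m _ _ => (F.wt_pos m).le
  simp only [Finset.mem_filter, Finset.mem_univ, true_and, Finset.mem_erase] at hm ⊢
  exact ⟨(hm.2.trans_lt h).ne, hsub.trans hm.1, hm.2.trans h.le⟩

theorem Sorted.level_le_depth (hF : F.Sorted) {v : V} {j : Fin F.n} (hj : v ∈ F.cut j) :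
    F.level j ≤ F.depth {v} := by
  rw [hF.level_eq (Finset.singleton_nonempty v) (by simpa using hj), depth]
  exact Finset.sum_le_sum_of_subset_of_nonneg (Finset.filter_subset _ _)
    fun m _ _ => (F.wt_pos m).le

variable (F)

theorem slot_mono (j : Fin F.n) : Monotone (F.slot j) := by
  intro x y hxy
  have h : (⌊F.level j - F.wt j⌋ : ℝ) ≤ ⌊F.level j⌋ := by exact_mod_cast F.floor_level_sub_le j
  simp only [slot]
  rcases min_cases x (⌊F.level j⌋ : ℝ) with h1 | h1 <;>
  rcases min_cases x (⌊F.level j - F.wt j⌋ : ℝ) with h2 | h2 <;>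
  rcases min_cases y (⌊F.level j⌋ : ℝ) with h3 | h3 <;>
  rcases min_cases y (⌊F.level j - F.wt j⌋ : ℝ) with h4 | h4 <;> linarith

theorem slot_zero (j : Fin F.n) : F.slot j 0 = 0 := by
  have h1 : (0 : ℝ) ≤ ⌊F.level j - F.wt j⌋ := by
    exact_mod_cast Int.floor_nonneg.2 (F.level_sub_nonneg j)
  have h2 : (0 : ℝ) ≤ ⌊F.level j⌋ := by exact_mod_cast Int.floor_nonneg.2 (F.level_nonneg j)
  simp [slot, min_eq_left h1, min_eq_left h2]

theorem slot_le_one (j : Fin F.n) (x : ℝ) : F.slot j x ≤ 1 := by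
  have h : (⌊F.level j⌋ : ℝ) ≤ ⌊F.level j - F.wt j⌋ + 1 := by exact_mod_cast F.floor_level_le j
  simp only [slot]
  rcases min_cases x (⌊F.level j⌋ : ℝ) with h1 | h1 <;>
  rcases min_cases x (⌊F.level j - F.wt j⌋ : ℝ) with h2 | h2 <;> linarith

variable {F}

theorem Sorted.slot_sub_eq_zero (hF : F.Sorted) {j l : Fin F.n} (h : j < l)
    (hne : (F.cut l ∩ F.cut j).Nonempty) :
    F.slot j (F.level l) - F.slot j (F.level l - F.wt l) = 0 := by
  have h1 := hF.level_le h hne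
  have h2 : F.level l - F.wt l ≤ F.level l := by linarith [F.wt_pos l]
  have h3 : (⌊F.level j⌋ : ℝ) ≤ F.level j := Int.floor_le _
  have h4 : (⌊F.level j - F.wt j⌋ : ℝ) ≤ ⌊F.level j⌋ := by exact_mod_cast F.floor_level_sub_le j
  simp only [slot]
  rw [min_eq_right (by linarith), min_eq_right (by linarith), min_eq_right (by linarith),
    min_eq_right (by linarith), sub_self]

theorem Sorted.sum_slot (hF : F.Sorted) (v : V) {x : ℝ} (hx : 0 ≤ x) :
    ∑ j with v ∈ F.cut j, F.slot j x = min x ⌊F.depth {v}⌋ := by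
  have := hF.telescope (Finset.singleton_nonempty v) fun y => min x (⌊y⌋ : ℝ)
  simpa [slot, hx] using this

variable (F)

/-- The fractional assignment of terminals to cuts (each of capacity one) and to vertices: the
weight of a terminal at a point is moved to the next integer level, or else to its vertex. -/
noncomputable def share (i : T) : Fin F.n ⊕ V → ℝ
  | .inl j => if r i ∈ F.cut j then
      ∑ l with F.owner l = i, (F.slot j (F.level l) - F.slot j (F.level l - F.wt l)) else 0
  | .inr v => if r i = v then
      ∑ l with F.owner l = i, ((F.level l - min (F.level l) ⌊F.depth {v}⌋) -
        ((F.level l - F.wt l) - min (F.level l - F.wt l) ⌊F.depth {v}⌋)) else 0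

theorem slot_sub_nonneg (j l : Fin F.n) :
    0 ≤ F.slot j (F.level l) - F.slot j (F.level l - F.wt l) :=
  sub_nonneg.2 (F.slot_mono j (by linarith [F.wt_pos l]))

theorem remainder_sub_nonneg (l : Fin F.n) (b : ℝ) :
    0 ≤ (F.level l - min (F.level l) b) - ((F.level l - F.wt l) - min (F.level l - F.wt l) b) := by
  have := F.wt_pos l
  rcases min_cases (F.level l) b with h1 | h1 <;>
  rcases min_cases (F.level l - F.wt l) b with h2 | h2 <;> linarith

theorem share_nonneg (i : T) (a : Fin F.n ⊕ V) : 0 ≤ F.share i a := by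
  rcases a with j | v <;> simp only [share] <;> split_ifs
  · exact Finset.sum_nonneg fun l _ => F.slot_sub_nonneg j l
  · exact le_rfl
  · exact Finset.sum_nonneg fun l _ => F.remainder_sub_nonneg l _
  · exact le_rfl

variable {F}

theorem Sorted.sum_share_eq_one [Fintype V] (hF : F.Sorted) (i : T) :
    ∑ a, F.share i a = 1 := by
  rw [Fintype.sum_sum_type]
  simp only [share]
  rw [← Finset.sum_filter, Finset.sum_ite_eq, if_pos (Finset.mem_univ _), Finset.sum_comm,
    ← Finset.sum_add_distrib, ← F.wt_sum i]
  refine Finset.sum_congr rfl fun l _ => ?_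
  rw [Finset.sum_sub_distrib, hF.sum_slot _ (F.level_nonneg l),
    hF.sum_slot _ (F.level_sub_nonneg l)]
  ring

theorem sum_filter_sum_owner (p : T → Prop) [DecidablePred p] (g : Fin F.n → ℝ) :
    (∑ i, if p i then ∑ l with F.owner l = i, g l else 0) = ∑ l with p (F.owner l), g l := by
  rw [← Finset.sum_filter, Finset.sum_filter]
  simp only [Finset.sum_filter]
  have : ∀ i, (if p i then ∑ l, (if F.owner l = i then g l else 0) else 0) =
      ∑ l, if F.owner l = i then (if p (F.owner l) then g l else 0) else 0 := by
    intro i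
    split_ifs with h
    · exact Finset.sum_congr rfl fun l _ => by split_ifs with h1 h2 <;> simp_all
    · exact (Finset.sum_eq_zero fun l _ => by split_ifs with h1 h2 <;> simp_all).symm
  simp only [this]
  rw [Finset.sum_comm]
  simp

theorem Sorted.sum_share_le_one (hF : F.Sorted) (a : Fin F.n ⊕ V) :
    ∑ i, F.share i a ≤ 1 := by
  rcases a with j | v <;> simp only [share]
  · rw [F.sum_filter_sum_owner fun i => r i ∈ F.cut j]
    have h := hF.telescope ⟨_, F.root_mem j⟩ (F.slot j)
    rw [F.slot_zero] at h
    refine le_trans ?_ ((h.trans (sub_zero _)).trans_le (F.slot_le_one j _))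
    rw [← Finset.sum_filter_add_sum_filter_not (univ.filter fun l => r (F.owner l) ∈ F.cut j)
      (fun l => l ≤ j)]
    rw [Finset.sum_eq_zero (s := (univ.filter fun l => r (F.owner l) ∈ F.cut j).filter
      fun l => ¬ l ≤ j), add_zero]
    · refine Finset.sum_le_sum_of_subset_of_nonneg (fun l hl => ?_)
        fun l _ _ => F.slot_sub_nonneg j l
      simp only [Finset.mem_filter, Finset.mem_univ, true_and] at hl ⊢
      exact hF.cut_subset hl.2 ⟨_, Finset.mem_inter.2 ⟨hl.1, F.root_mem l⟩⟩
    · intro l hl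
      simp only [Finset.mem_filter, Finset.mem_univ, true_and, not_le] at hl
      exact hF.slot_sub_eq_zero hl.2 ⟨_, Finset.mem_inter.2 ⟨F.root_mem l, hl.1⟩⟩
  · rw [F.sum_filter_sum_owner fun i => r i = v]
    have h := hF.telescope (Finset.singleton_nonempty v) fun x => x - min x ⌊F.depth {v}⌋
    have h0 : (0 : ℝ) ≤ ⌊F.depth {v}⌋ := by exact_mod_cast Int.floor_nonneg.2 (F.depth_nonneg _)
    have h1 := (Int.lt_floor_add_one (F.depth {v})).le
    rw [min_eq_right (Int.floor_le _), min_eq_left h0] at h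
    refine le_trans ?_ (h.trans_le (by linarith))
    refine Finset.sum_le_sum_of_subset_of_nonneg (fun l hl => ?_)
      fun l _ _ => F.remainder_sub_nonneg l _
    simp only [Finset.mem_filter, Finset.mem_univ, true_and, Finset.singleton_subset_iff] at hl ⊢
    exact hl ▸ F.root_mem l

theorem Sorted.of_share_inl_ne_zero (hF : F.Sorted) {i : T} {j : Fin F.n}
    (h : F.share i (.inl j) ≠ 0) :
    r i ∈ F.cut j ∧ ⌊F.level j - F.wt j⌋ < ⌊F.level j⌋ ∧
      ∃ l, F.owner l = i ∧ F.cut j ⊆ F.cut l := by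
  simp only [share, ne_eq, ite_eq_right_iff, Classical.not_imp] at h
  obtain ⟨hi, h⟩ := h
  obtain ⟨l, hl, hne⟩ := Finset.exists_ne_zero_of_sum_ne_zero h
  have hl : F.owner l = i := by simpa using hl
  have hmem : r i ∈ F.cut l := hl ▸ F.root_mem l
  refine ⟨hi, lt_of_le_of_ne (F.floor_level_sub_le j) fun heq => hne (by simp [slot, heq]), l, hl,
    hF.cut_subset ?_ ⟨_, Finset.mem_inter.2 ⟨hi, hmem⟩⟩⟩
  by_contra hlt
  exact hne (hF.slot_sub_eq_zero (not_le.1 hlt) ⟨_, Finset.mem_inter.2 ⟨hmem, hi⟩⟩)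

/-- The number of cuts separating `u` from `v` whose interval of levels ends past an integer. -/
theorem Sorted.card_slots_le (hF : F.Sorted) (u v : V) :
    ((univ.filter fun j => (u ∈ F.cut j ∧ v ∉ F.cut j) ∧
      ⌊F.level j - F.wt j⌋ < ⌊F.level j⌋).card : ℤ) ≤ ⌊F.depth {u}⌋ - ⌊F.depth {u, v}⌋ := by
  have h1 := hF.telescope (Finset.singleton_nonempty u) fun x => (⌊x⌋ : ℝ)
  have h2 := hF.telescope (Finset.insert_nonempty u {v}) fun x => (⌊x⌋ : ℝ)
  simp only [Finset.singleton_subset_iff, Finset.insert_subset_iff, Int.floor_zero, Int.cast_zero,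
    sub_zero] at h1 h2
  rw [← Finset.sum_filter_add_sum_filter_not _ (fun j => v ∈ F.cut j), Finset.filter_filter,
    Finset.filter_filter, h2] at h1
  have h3 : ((univ.filter fun j => (u ∈ F.cut j ∧ v ∉ F.cut j) ∧
      ⌊F.level j - F.wt j⌋ < ⌊F.level j⌋).card : ℝ) ≤
      ∑ j with u ∈ F.cut j ∧ v ∉ F.cut j,
        ((⌊F.level j⌋ : ℝ) - ⌊F.level j - F.wt j⌋) := by
    rw [← Finset.filter_filter, Finset.card_filter, Nat.cast_sum]
    refine Finset.sum_le_sum fun j _ => ?_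
    split_ifs with h
    · have : (⌊F.level j - F.wt j⌋ : ℝ) + 1 ≤ ⌊F.level j⌋ := by exact_mod_cast h
      push_cast
      linarith
    · have : (⌊F.level j - F.wt j⌋ : ℝ) ≤ ⌊F.level j⌋ := by exact_mod_cast F.floor_level_sub_le j
      push_cast
      linarith
  have h4 := h3.trans_eq (eq_sub_of_add_eq' h1)
  exact_mod_cast h4

theorem load_eq (F : FracLaminarFamily V T r) (u v : V) :
    F.load u v = F.depth {u} + F.depth {v} - 2 * F.depth {u, v} := by
  simp only [load, depth, Finset.singleton_subset_iff, Finset.insert_subset_iff,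
    Finset.sum_filter, Finset.mul_sum, ← Finset.sum_add_distrib, ← Finset.sum_sub_distrib]
  refine Finset.sum_congr rfl fun j _ => ?_
  by_cases hu : u ∈ F.cut j <;> by_cases hv : v ∈ F.cut j <;> simp [hu, hv]
  ring

/-- The integral cut of terminal `i` assigned to `a`. -/
def roundedCut (F : FracLaminarFamily V T r) (i : T) : Fin F.n ⊕ V → Finset V
  | .inl j => F.cut j
  | .inr _ => {r i}

theorem Sorted.card_rounded_le (hF : F.Sorted) {f : T → Fin F.n ⊕ V}
    (hf : Function.Injective f) (hshare : ∀ i, F.share i (f i) ≠ 0) (u v : V) :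
    ((univ.filter fun i => u ∈ F.roundedCut i (f i) ∧ v ∉ F.roundedCut i (f i)).card : ℤ)
      ≤ ⌊F.depth {u}⌋ - ⌊F.depth {u, v}⌋ + 1 := by
  set s := univ.filter fun j => (u ∈ F.cut j ∧ v ∉ F.cut j) ∧
      ⌊F.level j - F.wt j⌋ < ⌊F.level j⌋ with hs
  have hsub : (univ.filter fun i => u ∈ F.roundedCut i (f i) ∧ v ∉ F.roundedCut i (f i)).card
      ≤ (s.disjSum {u}).card := by
    refine Finset.card_le_card_of_injOn f (fun i hi => ?_) hf.injOn
    have hi := (Finset.mem_filter.1 (Finset.mem_coe.1 hi)).2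
    have hne := hshare i
    rw [Finset.mem_coe]
    rcases hfi : f i with j | z
    · rw [hfi] at hi hne
      simp only [Finset.inl_mem_disjSum, hs, Finset.mem_filter, Finset.mem_univ, true_and]
      exact ⟨hi, (hF.of_share_inl_ne_zero hne).2.1⟩
    · rw [hfi] at hi hne
      simp only [share, ne_eq, ite_eq_right_iff, Classical.not_imp] at hne
      simp only [roundedCut, Finset.mem_singleton] at hi
      simp [← hne.1, hi.1]
  rw [Finset.card_disjSum, Finset.card_singleton] at hsub
  have := hF.card_slots_le u v
  rw [← hs] at this
  omega

theorem Sorted.exists_rounding [Fintype V] (hF : F.Sorted) :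
    ∃ A : T → Finset V, (∀ i, r i ∈ A i) ∧
      (∀ i, A i = {r i} ∨ ∃ l, F.owner l = i ∧ A i ⊆ F.cut l) ∧
      ∀ (u v : V) (c : ℕ), F.load u v ≤ c →
        (univ.filter fun i => ¬((u ∈ A i) ↔ (v ∈ A i))).card ≤ c + 3 := by
  obtain ⟨f, hf, hshare⟩ := exists_injective_of_fractional_matching F.share F.share_nonneg
    hF.sum_share_eq_one hF.sum_share_le_one
  refine ⟨fun i => F.roundedCut i (f i), fun i => ?_, fun i => ?_, fun u v c hc => ?_⟩
  · have hne := hshare i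
    beta_reduce
    rcases hfi : f i with j | z
    · rw [hfi] at hne
      exact (hF.of_share_inl_ne_zero hne).1
    · exact Finset.mem_singleton_self _
  · have hne := hshare i
    beta_reduce
    rcases hfi : f i with j | z
    · rw [hfi] at hne
      exact .inr (hF.of_share_inl_ne_zero hne).2.2
    · exact .inl rfl
  · have h1 := hF.card_rounded_le hf hshare u v
    have h2 := hF.card_rounded_le hf hshare v u
    rw [Finset.pair_comm v u] at h2
    have h3 : (univ.filter fun i => ¬((u ∈ F.roundedCut i (f i)) ↔
        (v ∈ F.roundedCut i (f i)))).card ≤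
        (univ.filter fun i => u ∈ F.roundedCut i (f i) ∧ v ∉ F.roundedCut i (f i)).card +
        (univ.filter fun i => v ∈ F.roundedCut i (f i) ∧ u ∉ F.roundedCut i (f i)).card := by
      refine (Finset.card_le_card fun i hi => ?_).trans (Finset.card_union_le _ _)
      simp only [Finset.mem_filter, Finset.mem_univ, true_and, Finset.mem_union] at hi ⊢
      tauto
    rw [load_eq] at hc
    have h4 := Int.floor_le (F.depth {u})
    have h5 := Int.floor_le (F.depth {v})
    have h6 := Int.lt_floor_add_one (F.depth {u, v})
    have h7 : ⌊F.depth {u}⌋ + ⌊F.depth {v}⌋ < c + 2 * ⌊F.depth {u, v}⌋ + 2 := by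
      have : (⌊F.depth {u}⌋ : ℝ) + ⌊F.depth {v}⌋ < c + 2 * ⌊F.depth {u, v}⌋ + 2 := by linarith
      exact_mod_cast this
    beta_reduce
    omega

/-- The family with its cuts listed in the order `σ`. -/
def reindex (F : FracLaminarFamily V T r) (σ : Equiv.Perm (Fin F.n)) :
    FracLaminarFamily V T r where
  n := F.n
  cut j := F.cut (σ j)
  wt j := F.wt (σ j)
  owner j := F.owner (σ j)
  wt_pos j := F.wt_pos (σ j)
  laminar j l := F.laminar (σ j) (σ l)
  root_mem j := F.root_mem (σ j)
  wt_sum i := by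
    rw [← F.wt_sum i, Finset.sum_filter, Finset.sum_filter]
    exact Equiv.sum_comp σ fun j => if F.owner j = i then F.wt j else 0

theorem load_reindex (F : FracLaminarFamily V T r) (σ : Equiv.Perm (Fin F.n)) (u v : V) :
    (F.reindex σ).load u v = F.load u v :=
  Equiv.sum_comp σ fun j => if ¬((u ∈ F.cut j) ↔ (v ∈ F.cut j)) then F.wt j else 0

theorem exists_sorted_reindex (F : FracLaminarFamily V T r) :
    ∃ σ : Equiv.Perm (Fin F.n), (F.reindex σ).Sorted :=
  ⟨Tuple.sort fun j => OrderDual.toDual (F.cut j).card, fun _ _ h =>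
    OrderDual.toDual_le_toDual.1
      (Tuple.monotone_sort (fun j => OrderDual.toDual (F.cut j).card) h)⟩

end FracLaminarFamily

/-- **Rounding for multiway cut packing (Lemma `Round-2`).**
If an MCP instance (commodities `S 0, …, S (k-1)`, terminals `T = ⋃ a, S a`
located at `r i`, distinct terminals of the same commodity at distinct
vertices, positive integer capacities `c`) admits a feasible fractional
laminar cut family — for every commodity `a` and distinct `i, j ∈ S a`,
either `r j` lies in no cut of `i` or `r i` lies in no cut of `j`, and the
load on every edge is at most its capacity — then there are integral cuts
`A i ∋ r i` such that for every commodity `a` and distinct `i, j ∈ S a`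
either `r j ∉ A i` or `r i ∉ A j`, and every edge `{u,v}` crosses at most
`c {u,v} + 3` of the cuts `δ(A i)`. -/
theorem mcp_rounding
    {V T : Type} [Fintype V] [DecidableEq V] [Fintype T] [DecidableEq T]
    (G : SimpleGraph V) [DecidableRel G.Adj]
    (c : Sym2 V → ℕ) (hc : ∀ e ∈ G.edgeSet, 0 < c e)
    (k : ℕ) (S : Fin k → Finset T) (hcover : ∀ i : T, ∃ a, i ∈ S a)
    (r : T → V)
    (hinj : ∀ a, ∀ i ∈ S a, ∀ j ∈ S a, i ≠ j → r i ≠ r j)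
    (F : FracLaminarFamily V T r)
    (hFsep : ∀ a, ∀ i ∈ S a, ∀ j ∈ S a, i ≠ j →
      (∀ jc, F.owner jc = i → r j ∉ F.cut jc) ∨
      (∀ jc, F.owner jc = j → r i ∉ F.cut jc))
    (hFload : ∀ u v, G.Adj u v → F.load u v ≤ (c s(u, v) : ℝ)) :
    ∃ A : T → Finset V,
      (∀ i, r i ∈ A i) ∧
      (∀ a, ∀ i ∈ S a, ∀ j ∈ S a, i ≠ j → r j ∉ A i ∨ r i ∉ A j) ∧
      (∀ u v, G.Adj u v →
        (univ.filter fun i => ¬((u ∈ A i) ↔ (v ∈ A i))).card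
          ≤ c s(u, v) + 3) := by
  obtain ⟨σ, hσ⟩ := F.exists_sorted_reindex
  obtain ⟨A, hroot, hA, hload⟩ := hσ.exists_rounding
  have hnot : ∀ i v, v ≠ r i → (∀ j, F.owner j = i → v ∉ F.cut j) → v ∉ A i := by
    intro i v hv hcut hmem
    rcases hA i with h | ⟨l, hl, hsub⟩
    · exact hv (by simpa [h] using hmem)
    · exact hcut (σ l) hl (hsub hmem)
  refine ⟨A, hroot, fun a i hi j hj hij => ?_, fun u v huv => ?_⟩
  · have hr := hinj a i hi j hj hij
    exact (hFsep a i hi j hj hij).imp (hnot i (r j) hr.symm) (hnot j (r i) hr)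
  · exact hload u v _ ((F.load_reindex σ u v).trans_le (hFload u v huv))
end

section
/- Let G be a finite simple undirected graph on n vertices r_1,…,r_n, and let 1 ≤ k ≤ n. Construct G' from G by adding n−k+1 new vertices t=u_1, u_2, …, u_{n−k+1}=v joined in a path (edges {u_b, u_{b+1}} for 1 ≤ b ≤ n−k), and joining v to every vertex of G. Then the following are equivalent: (1) there exist pairwise disjoint edge sets F_1,…,F_n ⊆ E(G') such that for every i, the vertices r_i and t lie in different connected components of the graph obtained from G' by deleting the edges F_i; (2) G contains an independent set of size at least k. -/
open Finset

/-- the vertex set of the auxiliary graph `G'`: the `n` vertices of `G`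
together with `n - k + 1` new chain vertices `t = u_1, …, u_{n-k+1} = v`. -/
abbrev ReductionVertex (n k : ℕ) : Type := Fin n ⊕ Fin (n - k + 1)

/-- the common sink `t`, the first vertex of the chain. -/
def reductionSink (n k : ℕ) : ReductionVertex n k :=
  Sum.inr ⟨0, Nat.succ_pos _⟩

/-- the vertex `v`, the last vertex of the chain. -/
def reductionV (n k : ℕ) : ReductionVertex n k :=
  Sum.inr ⟨n - k, Nat.lt_succ_self _⟩

/-- the auxiliary graph `G'`: a copy of `G`, the path
`t = u_1 — u_2 — ⋯ — u_{n-k+1} = v` on the new vertices, and an edge from `v`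
to every vertex of `G`. -/
def reductionGraph (n k : ℕ) (G : SimpleGraph (Fin n)) :
    SimpleGraph (ReductionVertex n k) :=
  SimpleGraph.fromRel (fun x y =>
    (∃ a b : Fin n, x = Sum.inl a ∧ y = Sum.inl b ∧ G.Adj a b) ∨
    (∃ a : Fin n, x = Sum.inl a ∧ y = reductionV n k) ∨
    (∃ b b' : Fin (n - k + 1), x = Sum.inr b ∧ y = Sum.inr b' ∧
      (b : ℕ) + 1 = (b' : ℕ)))

section ReductionGraph

variable {n k : ℕ} {G : SimpleGraph (Fin n)}

theorem reductionGraph_adj_inl_inl {a b : Fin n} :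
    (reductionGraph n k G).Adj (Sum.inl a) (Sum.inl b) ↔ G.Adj a b := by
  simp only [reductionGraph, reductionV, SimpleGraph.fromRel_adj]
  constructor
  · rintro ⟨-, h⟩
    simpa [G.adj_comm b a] using h
  · intro h
    exact ⟨by simpa using h.ne, by simp [h]⟩

theorem reductionGraph_adj_inl_inr {a : Fin n} {c : Fin (n - k + 1)} :
    (reductionGraph n k G).Adj (Sum.inl a) (Sum.inr c) ↔ (c : ℕ) = n - k := by
  simp [reductionGraph, reductionV, Fin.ext_iff]

theorem reductionGraph_adj_inr_inr {b c : Fin (n - k + 1)} :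
    (reductionGraph n k G).Adj (Sum.inr b) (Sum.inr c) ↔
      (b : ℕ) + 1 = c ∨ (c : ℕ) + 1 = b := by
  simp only [reductionGraph, reductionV, SimpleGraph.fromRel_adj]
  constructor
  · rintro ⟨-, h⟩
    simpa using h
  · intro h
    refine ⟨fun hbc => ?_, by simpa using h⟩
    rw [Sum.inr.injEq, Fin.ext_iff] at hbc
    omega

/-- The edges of the path from the sink `t` to `v`. -/
def chainEdge (n k : ℕ) (b : Fin (n - k)) : Sym2 (ReductionVertex n k) :=
  s(Sum.inr b.castSucc, Sum.inr b.succ)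

theorem chainEdge_mem_edgeSet (b : Fin (n - k)) :
    chainEdge n k b ∈ (reductionGraph n k G).edgeSet := by
  simp [chainEdge, reductionGraph_adj_inr_inr]

theorem chainEdge_injective : Function.Injective (chainEdge n k) := by
  intro b c h
  simp only [chainEdge, Sym2.eq_iff, Sum.inr.injEq, Fin.ext_iff, Fin.val_castSucc,
    Fin.val_succ] at h
  exact Fin.ext (by omega)

theorem inl_notMem_chainEdge (a : Fin n) (b : Fin (n - k)) :
    Sum.inl a ∉ chainEdge n k b := by
  simp [chainEdge]

theorem SimpleGraph.Reachable.mem_of_closed {V : Type*} {H : SimpleGraph V} {P : V → Prop}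
    (hP : ∀ x y, H.Adj x y → P x → P y) {x y : V} (h : H.Reachable x y) (hx : P x) : P y := by
  obtain ⟨w⟩ := h
  induction w with
  | nil => exact hx
  | cons hadj _ ih => exact ih (hP _ _ hadj hx)

theorem reachable_reductionSink_of_forall_chainEdge_notMem
    {F : Set (Sym2 (ReductionVertex n k))} (hF : ∀ b, chainEdge n k b ∉ F) :
    ((reductionGraph n k G).deleteEdges F).Reachable (reductionV n k) (reductionSink n k) := by
  have key : ∀ c (hc : c < n - k + 1), ((reductionGraph n k G).deleteEdges F).Reachable
      (Sum.inr ⟨c, hc⟩) (reductionSink n k) := by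
    intro c
    induction c with
    | zero => exact fun _ => SimpleGraph.Reachable.rfl
    | succ c ih =>
      intro hc
      refine SimpleGraph.Reachable.trans (SimpleGraph.Adj.reachable ?_) (ih (by omega))
      refine SimpleGraph.Adj.symm ?_
      rw [SimpleGraph.deleteEdges_adj]
      exact ⟨reductionGraph_adj_inr_inr.2 (Or.inl rfl), hF ⟨c, by omega⟩⟩
  exact key _ _

theorem not_reachable_deleteEdges_incidenceSet (i : Fin n) :
    ¬ ((reductionGraph n k G).deleteEdges
      ((reductionGraph n k G).incidenceSet (Sum.inl i))).Reachable
        (Sum.inl i) (reductionSink n k) := by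
  intro h
  have := h.mem_of_closed (P := fun x => x = Sum.inl i) ?_ rfl
  · simp [reductionSink] at this
  · rintro x y hxy rfl
    rw [SimpleGraph.deleteEdges_adj] at hxy
    exact absurd ⟨hxy.1, Sym2.mem_mk_left _ _⟩ hxy.2

theorem not_reachable_deleteEdges_chainEdge (i : Fin n) (b : Fin (n - k)) :
    ¬ ((reductionGraph n k G).deleteEdges {chainEdge n k b}).Reachable
        (Sum.inl i) (reductionSink n k) := by
  intro h
  have := h.symm.mem_of_closed
    (P := fun x => ∃ c : Fin (n - k + 1), x = Sum.inr c ∧ (c : ℕ) ≤ b) ?_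
    ⟨_, rfl, Nat.zero_le _⟩
  · simp at this
  · rintro _ y hxy ⟨c, rfl, hc⟩
    rw [SimpleGraph.deleteEdges_adj] at hxy
    obtain ⟨hadj, hne⟩ := hxy
    rcases y with a | d
    · have := reductionGraph_adj_inl_inr.1 hadj.symm
      have := b.isLt
      omega
    · refine ⟨d, rfl, ?_⟩
      rw [reductionGraph_adj_inr_inr] at hadj
      by_contra hd
      refine hne ?_
      simp only [chainEdge, Set.mem_singleton_iff, Sym2.eq_iff, Sum.inr.injEq, Fin.ext_iff,
        Fin.val_castSucc, Fin.val_succ]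
      omega

/-- The indices whose cut avoids the path from `t` to `v` form an independent set. -/
theorem not_adj_of_forall_chainEdge_notMem {F : Fin n → Set (Sym2 (ReductionVertex n k))}
    (hdisj : ∀ i j, i ≠ j → Disjoint (F i) (F j))
    (hcut : ∀ i, ¬ ((reductionGraph n k G).deleteEdges (F i)).Reachable
      (Sum.inl i) (reductionSink n k))
    {i j : Fin n} (hi : ∀ b, chainEdge n k b ∉ F i) (hj : ∀ b, chainEdge n k b ∉ F j) :
    ¬ G.Adj i j := by
  have star : ∀ {l}, (∀ b, chainEdge n k b ∉ F l) → ∀ {m},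
      ((reductionGraph n k G).deleteEdges (F l)).Reachable (Sum.inl l) (Sum.inl m) →
      s(Sum.inl m, reductionV n k) ∈ F l := by
    intro l hl m hlm
    by_contra hmem
    refine hcut l (hlm.trans (SimpleGraph.Reachable.trans (SimpleGraph.Adj.reachable ?_)
      (reachable_reductionSink_of_forall_chainEdge_notMem hl)))
    rw [SimpleGraph.deleteEdges_adj]
    exact ⟨reductionGraph_adj_inl_inr.2 rfl, hmem⟩
  have edge : ∀ {l m}, (∀ b, chainEdge n k b ∉ F l) → (∀ b, chainEdge n k b ∉ F m) →
      G.Adj l m → s(Sum.inl l, Sum.inl m) ∈ F l := by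
    intro l m hl hm hadj
    by_contra hmem
    have hreach : ((reductionGraph n k G).deleteEdges (F l)).Adj (Sum.inl l) (Sum.inl m) := by
      rw [SimpleGraph.deleteEdges_adj]
      exact ⟨reductionGraph_adj_inl_inl.2 hadj, hmem⟩
    exact Set.disjoint_left.1 (hdisj l m hadj.ne) (star hl hreach.reachable)
      (star hm SimpleGraph.Reachable.rfl)
  intro hadj
  have hji := edge hj hi hadj.symm
  rw [Sym2.eq_swap] at hji
  exact Set.disjoint_left.1 (hdisj i j hadj.ne) (edge hi hj hadj) hji

end ReductionGraph

/-- **NP-hardness reduction for common-sink s-t cut packing.**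
For a graph `G` on `n` vertices and `1 ≤ k ≤ n`, the auxiliary graph `G'`
admits `n` pairwise edge-disjoint cuts, the `i`-th separating the `i`-th
vertex of `G` from the sink `t`, if and only if `G` contains an independent
set of size at least `k`. -/
theorem cscp_np_hardness_reduction (n k : ℕ) (hk1 : 1 ≤ k) (hkn : k ≤ n)
    (G : SimpleGraph (Fin n)) :
    (∃ F : Fin n → Set (Sym2 (ReductionVertex n k)),
        (∀ i, F i ⊆ (reductionGraph n k G).edgeSet) ∧
        (∀ i j, i ≠ j → Disjoint (F i) (F j)) ∧
        (∀ i, ¬ ((reductionGraph n k G).deleteEdges (F i)).Reachable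
          (Sum.inl i) (reductionSink n k)))
      ↔
    (∃ s : Finset (Fin n), k ≤ s.card ∧
        ∀ i ∈ s, ∀ j ∈ s, ¬ G.Adj i j) := by
  classical
  constructor
  · rintro ⟨F, -, hdisj, hcut⟩
    refine ⟨univ.filter fun i => ∀ b, chainEdge n k b ∉ F i, ?_, fun i hi j hj =>
      not_adj_of_forall_chainEdge_notMem hdisj hcut (by simpa using hi) (by simpa using hj)⟩
    have hex : ∀ i : {i // ¬ ∀ b, chainEdge n k b ∉ F i}, ∃ b, chainEdge n k b ∈ F i := by
      rintro ⟨i, hi⟩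
      simpa using hi
    choose f hf using hex
    have hinj : Function.Injective f := by
      intro i j hij
      by_contra hne
      refine Set.disjoint_left.1 (hdisj i j (fun h => hne (Subtype.ext h))) (hf i) ?_
      rw [hij]
      exact hf j
    have hcard := Fintype.card_le_of_injective f hinj
    rw [Fintype.card_subtype, Fintype.card_fin] at hcard
    have hsum := Finset.card_filter_add_card_filter_not (s := (univ : Finset (Fin n)))
      (fun i => ∀ b, chainEdge n k b ∉ F i)
    rw [Finset.card_univ, Fintype.card_fin] at hsum
    omega
  · rintro ⟨s, hs, hind⟩
    have hcard : Fintype.card {i // i ∉ s} ≤ Fintype.card (Fin (n - k)) := by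
      rw [Fintype.card_subtype_compl, Fintype.card_coe, Fintype.card_fin, Fintype.card_fin]
      omega
    obtain ⟨f⟩ := Function.Embedding.nonempty_of_card_le hcard
    refine ⟨fun i => if h : i ∈ s then (reductionGraph n k G).incidenceSet (Sum.inl i)
      else {chainEdge n k (f ⟨i, h⟩)}, fun i => ?_, fun i j hij => ?_, fun i => ?_⟩
    · by_cases h : i ∈ s
      · simpa [h] using SimpleGraph.incidenceSet_subset _ _
      · simpa [h] using chainEdge_mem_edgeSet _
    · by_cases hi : i ∈ s <;> by_cases hj : j ∈ s <;> simp only [hi, hj, dite_true, dite_false]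
      · rw [Set.disjoint_iff_inter_eq_empty]
        exact SimpleGraph.incidenceSet_inter_incidenceSet_of_not_adj _
          (fun h => hind i hi j hj (reductionGraph_adj_inl_inl.1 h)) (by simpa using hij)
      · exact Set.disjoint_singleton_right.2 fun h => inl_notMem_chainEdge _ _ h.2
      · exact Set.disjoint_singleton_left.2 fun h => inl_notMem_chainEdge _ _ h.2
      · exact Set.disjoint_singleton.2 fun h =>
          hij (Subtype.ext_iff.1 (f.injective (chainEdge_injective h)))
    · by_cases h : i ∈ s
      · simpa only [h, dite_true] using not_reachable_deleteEdges_incidenceSet i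
      · simpa only [h, dite_false] using not_reachable_deleteEdges_chainEdge i _
end

section
/- There exists an instance of the common-sink s-t cut packing problem — a finite simple undirected graph G=(V,E) with unit capacities, a sink vertex t, and source terminals at vertices r_1,…,r_m, each r_a ≠ t — with the following two properties. (1) There is a fractional feasible solution of load 1: for each a a finite collection of pairs (C,w), C ⊆ V, w > 0, with r_a ∈ C and t ∉ C for every such cut, the weights for each a summing to 1, such that for every edge e the total weight of all cuts C (over all a) with e ∈ δ(C) is at most 1. (2) In every integral solution, i.e., every choice of sets A_1,…,A_m ⊆ V with r_a ∈ A_a and t ∉ A_a for all a, some edge e belongs to δ(A_a) for at least 2 indices a. In particular, the integrality gap of the natural LP relaxation of the common-sink s-t cut packing problem is at least 2. -/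
open Finset

/-- Two triangles `0 1 2` and `1 3 4` sharing the vertex `1`. -/
def bowtie : SimpleGraph (Fin 5) where
  Adj u v := u ≠ v ∧ ((u ∈ ({0, 1, 2} : Finset (Fin 5)) ∧ v ∈ ({0, 1, 2} : Finset (Fin 5))) ∨
    (u ∈ ({1, 3, 4} : Finset (Fin 5)) ∧ v ∈ ({1, 3, 4} : Finset (Fin 5))))
  symm := ⟨fun _ _ h => ⟨h.1.symm, h.2.imp And.symm And.symm⟩⟩
  loopless := ⟨fun _ h => h.1 rfl⟩

instance : DecidableRel bowtie.Adj := fun _ _ => inferInstanceAs (Decidable (_ ∧ _))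

/-- The cuts of a half-integral solution on `bowtie` with sink `0` and sources `2, 3, 4`. -/
def bowtieCut : Fin 3 → Fin 2 → Finset (Fin 5) :=
  ![![{2}, {1, 2, 3, 4}], ![{3}, {1, 3, 4}], ![{4}, {3, 4}]]

/-- **Integrality gap of 2 for common-sink s-t cut packing.**
There is an instance of the CSCP with unit capacities — a finite simple graph
`G`, a sink `t`, and sources `r 0, …, r (m-1)`, each distinct from `t` — that
admits a fractional feasible solution of load `1` (for each `a` a finite
weighted collection of cuts containing `r a` and avoiding `t`, with weights
summing to `1`, whose total weight crossing any edge is at most `1`), yet in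
every integral solution `A 0, …, A (m-1)` (with `r a ∈ A a`, `t ∉ A a`) some
edge crosses at least `2` of the cuts `δ(A a)`. -/
theorem cscp_integrality_gap :
    ∃ (n : ℕ) (G : SimpleGraph (Fin n)) (t : Fin n) (m : ℕ)
      (r : Fin m → Fin n),
      (∀ a, r a ≠ t) ∧
      (∃ (J : Fin m → ℕ)
         (cut : (a : Fin m) → Fin (J a) → Finset (Fin n))
         (w : (a : Fin m) → Fin (J a) → ℝ),
        (∀ a j, 0 < w a j) ∧
        (∀ a j, r a ∈ cut a j) ∧
        (∀ a j, t ∉ cut a j) ∧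
        (∀ a, ∑ j, w a j = 1) ∧
        (∀ u v : Fin n, G.Adj u v →
          ∑ a, ∑ j, (if ¬((u ∈ cut a j) ↔ (v ∈ cut a j)) then w a j else 0)
            ≤ 1)) ∧
      (∀ A : Fin m → Finset (Fin n), (∀ a, r a ∈ A a ∧ t ∉ A a) →
        ∃ u v : Fin n, G.Adj u v ∧
          2 ≤ (univ.filter fun a => ¬((u ∈ A a) ↔ (v ∈ A a))).card) := by
  refine ⟨5, bowtie, 0, 3, ![2, 3, 4], by decide, ?_, ?_⟩
  · refine ⟨fun _ => 2, bowtieCut,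
      fun _ _ => 1 / 2, fun _ _ => by norm_num, by decide, by decide,
      fun _ => by norm_num, ?_⟩
    have crossing_le : ∀ u v : Fin 5, bowtie.Adj u v →
        ∑ a, ∑ j, (if ¬((u ∈ bowtieCut a j) ↔ (v ∈ bowtieCut a j)) then 1 else 0) ≤ 2 := by
      decide
    intro u v huv
    have h : ((∑ a, ∑ j, (if ¬((u ∈ bowtieCut a j) ↔ (v ∈ bowtieCut a j))
        then 1 else 0 : ℕ) : ℕ) : ℝ) ≤ 2 := by exact_mod_cast crossing_le u v huv
    calc _ = ∑ a, ∑ j, (1 / 2 : ℝ) *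
          (if ¬((u ∈ bowtieCut a j) ↔ (v ∈ bowtieCut a j)) then 1 else 0) := by
            simp only [mul_ite, mul_one, mul_zero]
      _ ≤ 1 := by
        simp only [← mul_sum]
        push_cast at h
        linarith
  · intro A hA
    by_contra! hcon
    have key : ∀ u v : Fin 5, bowtie.Adj u v → ∀ a b : Fin 3, a ≠ b →
        (u ∈ A a ↔ v ∈ A a) ∨ (u ∈ A b ↔ v ∈ A b) := by
      intro u v huv a b hab
      by_contra h
      rw [not_or] at h
      exact (hcon u v huv).not_ge (one_lt_card.mpr ⟨a, by simp; tauto, b, by simp; tauto, hab⟩)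
    have edge : ∀ u v : Fin 5, bowtie.Adj u v →
        ((u ∈ A 0 ↔ v ∈ A 0) ∨ (u ∈ A 1 ↔ v ∈ A 1)) ∧
        ((u ∈ A 0 ↔ v ∈ A 0) ∨ (u ∈ A 2 ↔ v ∈ A 2)) ∧
        ((u ∈ A 1 ↔ v ∈ A 1) ∨ (u ∈ A 2 ↔ v ∈ A 2)) := fun u v h =>
      ⟨key u v h 0 1 (by decide), key u v h 0 2 (by decide), key u v h 1 2 (by decide)⟩
    have h01 := edge 0 1 (by decide)
    have h02 := edge 0 2 (by decide)
    have h12 := edge 1 2 (by decide)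
    have h13 := edge 1 3 (by decide)
    have h14 := edge 1 4 (by decide)
    have h34 := edge 3 4 (by decide)
    have r0 : 2 ∈ A 0 ∧ 0 ∉ A 0 := hA 0
    have r1 : 3 ∈ A 1 ∧ 0 ∉ A 1 := hA 1
    have r2 : 4 ∈ A 2 ∧ 0 ∉ A 2 := hA 2
    clear key edge hcon hA
    grind
end

section
/- Let V be a finite set, t ∈ V, and let A, B ⊆ V∖{t} be two sets that cross (i.e., A∩B, A∖B, B∖A are all nonempty). Let x ∈ A and y ∈ B. Then there exist sets A', B' ⊆ V∖{t} that do not cross, with x ∈ A' and y ∈ B', such that for every pair of elements u,v ∈ V: [A' contains exactly one of u,v] + [B' contains exactly one of u,v] ≤ [A contains exactly one of u,v] + [B contains exactly one of u,v], where [·] denotes the 0/1 indicator. (Consequently, replacing a crossing pair of cuts in a common-sink cut collection by the new pair does not increase the load on any edge, keeps each source inside its cut, and keeps the sink outside both cuts.) -/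
open Finset

/-- **Uncrossing a pair of common-sink cuts.**
Let `V` be a finite set, `t ∈ V`, and let `A, B ⊆ V \ {t}` be two sets that
cross. Let `x ∈ A` and `y ∈ B`. Then there are non-crossing sets
`A', B' ⊆ V \ {t}` with `x ∈ A'`, `y ∈ B'`, such that on every pair `u, v`
the number of the two new sets containing exactly one of `u, v` is at most
the number of the two old sets containing exactly one of `u, v`. -/
theorem uncross_common_sink_cuts {V : Type} [Fintype V] [DecidableEq V]
    (t : V) (A B : Finset V) (htA : t ∉ A) (htB : t ∉ B)
    (hcross : (A ∩ B).Nonempty ∧ (A \ B).Nonempty ∧ (B \ A).Nonempty)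
    (x : V) (hx : x ∈ A) (y : V) (hy : y ∈ B) :
    ∃ A' B' : Finset V,
      t ∉ A' ∧ t ∉ B' ∧
      ¬((A' ∩ B').Nonempty ∧ (A' \ B').Nonempty ∧ (B' \ A').Nonempty) ∧
      x ∈ A' ∧ y ∈ B' ∧
      ∀ u v : V,
        ((if ¬((u ∈ A') ↔ (v ∈ A')) then 1 else 0) +
         (if ¬((u ∈ B') ↔ (v ∈ B')) then 1 else 0) : ℕ) ≤
        (if ¬((u ∈ A) ↔ (v ∈ A)) then 1 else 0) +
        (if ¬((u ∈ B) ↔ (v ∈ B)) then 1 else 0) := by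
  by_cases hxB : x ∈ B
  · refine ⟨A ∩ B, A ∪ B, by simp [htA], by simp [htA, htB], ?_, by simp [hx, hxB],
      by simp [hy], fun u v => ?_⟩
    · rintro ⟨-, ⟨z, hz⟩, -⟩
      simp only [mem_sdiff, mem_inter, mem_union] at hz
      tauto
    · by_cases u ∈ A <;> by_cases u ∈ B <;> by_cases v ∈ A <;> by_cases v ∈ B <;> simp [*]
  by_cases hyA : y ∈ A
  · refine ⟨A ∪ B, A ∩ B, by simp [htA, htB], by simp [htA], ?_, by simp [hx],
      by simp [hy, hyA], fun u v => ?_⟩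
    · rintro ⟨-, -, ⟨z, hz⟩⟩
      simp only [mem_sdiff, mem_inter, mem_union] at hz
      tauto
    · by_cases u ∈ A <;> by_cases u ∈ B <;> by_cases v ∈ A <;> by_cases v ∈ B <;> simp [*]
  · refine ⟨A \ B, B \ A, by simp [htA], by simp [htB], ?_, by simp [hx, hxB],
      by simp [hy, hyA], fun u v => ?_⟩
    · rintro ⟨⟨z, hz⟩, -, -⟩
      simp only [mem_sdiff, mem_inter] at hz
      tauto
    · by_cases u ∈ A <;> by_cases u ∈ B <;> by_cases v ∈ A <;> by_cases v ∈ B <;> simp [*]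
end

section
/- Let V be a finite set and d : V×V → ℝ≥0 a function with d(x,x)=0, d(x,y)=d(y,x), and d(x,y) ≤ d(x,z)+d(z,y) for all x,y,z ∈ V. Let R ⊆ V be a set of vertices with d(r,r') ≥ 1 for all distinct r,r' ∈ R. Then for all u,v ∈ V: Σ_{r∈R} | min(d(r,u), 1/2) − min(d(r,v), 1/2) | ≤ d(u,v). (Equivalently, the fractional family that assigns to each terminal r ∈ R the threshold cuts {x ∈ V : d(r,x) ≤ s} for s ∈ [0,1/2), with weight density 2, has load at most 2·d(u,v) on every edge {u,v}.) -/
open Finset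

/-- Truncating the distance to a point at a constant gives a `1`-Lipschitz function. -/
theorem abs_min_sub_min_le_of_triangle {V : Type*} {d : V → V → ℝ}
    (hdsymm : ∀ x y, d x y = d y x) (hdtri : ∀ x y z, d x y ≤ d x z + d z y)
    (r u v : V) (c : ℝ) : |min (d r u) c - min (d r v) c| ≤ d u v := by
  refine (abs_min_sub_min_le_max _ _ _ _).trans ?_
  rw [sub_self, abs_zero, max_eq_left (abs_nonneg _), abs_le]
  constructor <;> linarith [hdtri r u v, hdtri r v u, hdsymm u v]

/-- A point is at distance less than `1/2` from at most one element of a `1`-separated set. -/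
theorem half_le_of_separated {V : Type*} {d : V → V → ℝ}
    (hdsymm : ∀ x y, d x y = d y x) (hdtri : ∀ x y z, d x y ≤ d x z + d z y)
    {R : Finset V} (hR : ∀ r ∈ R, ∀ r' ∈ R, r ≠ r' → 1 ≤ d r r')
    {a r x : V} (ha : a ∈ R) (hr : r ∈ R) (hne : r ≠ a) (hax : d a x < 1 / 2) :
    1 / 2 ≤ d r x := by
  linarith [hR r hr a ha hne, hdtri r a x, hdsymm x a]

/-- The truncated difference vanishes when both distances are at least the truncation level. -/
theorem abs_min_sub_min_eq_zero {x y c : ℝ} (hx : c ≤ x) (hy : c ≤ y) :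
    |min x c - min y c| = 0 := by
  rw [min_eq_right hx, min_eq_right hy, sub_self, abs_zero]

/-- **Load of the family of threshold cuts.**
Let `d` be a semimetric on a finite set `V` and `R` a set of terminals at
pairwise distance at least `1`. Then for all `u, v`,
`∑ r ∈ R, |min (d r u) (1/2) − min (d r v) (1/2)| ≤ d u v`;
i.e. the fractional family assigning to each terminal `r ∈ R` the threshold
cuts `{x : d r x ≤ s}`, `s ∈ [0, 1/2)`, with weight density `2`, has load at
most `2 · d u v` on every edge `{u, v}`. -/
theorem threshold_cut_load {V : Type} [Fintype V] [DecidableEq V]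
    (d : V → V → ℝ)
    (hd0 : ∀ x y, 0 ≤ d x y)
    (hdrefl : ∀ x, d x x = 0)
    (hdsymm : ∀ x y, d x y = d y x)
    (hdtri : ∀ x y z, d x y ≤ d x z + d z y)
    (R : Finset V)
    (hR : ∀ r ∈ R, ∀ r' ∈ R, r ≠ r' → 1 ≤ d r r') :
    ∀ u v : V,
      ∑ r ∈ R, |min (d r u) (1 / 2) - min (d r v) (1 / 2)| ≤ d u v := by
  intro u v
  have lip (r : V) := abs_min_sub_min_le_of_triangle hdsymm hdtri r u v (1 / 2)
  have sep {a r x : V} := half_le_of_separated hdsymm hdtri hR (a := a) (r := r) (x := x)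
  by_cases hu : ∃ a ∈ R, d a u < 1 / 2
  · obtain ⟨a, ha, hau⟩ := hu
    by_cases hv : ∃ b ∈ R, b ≠ a ∧ d b v < 1 / 2
    · obtain ⟨b, hb, hba, hbv⟩ := hv
      rw [Finset.sum_eq_add_of_mem a b ha hb hba.symm fun r hr hne =>
        abs_min_sub_min_eq_zero (sep ha hr hne.1 hau) (sep hb hr hne.2 hbv)]
      have hav := sep hb ha hba.symm hbv
      have hbu := sep ha hb hba hau
      rw [min_eq_left hau.le, min_eq_right hav, min_eq_right hbu, min_eq_left hbv.le,
        abs_of_nonpos (by linarith), abs_of_nonneg (by linarith)]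
      linarith [hR a ha b hb hba.symm, hdtri a b u, hdtri u b v, hdsymm v b]
    · push Not at hv
      rw [Finset.sum_eq_single_of_mem a ha fun r hr hne =>
        abs_min_sub_min_eq_zero (sep ha hr hne hau) (hv r hr hne)]
      exact lip a
  · push Not at hu
    by_cases hv : ∃ b ∈ R, d b v < 1 / 2
    · obtain ⟨b, hb, hbv⟩ := hv
      rw [Finset.sum_eq_single_of_mem b hb fun r hr hne =>
        abs_min_sub_min_eq_zero (hu r hr) (sep hb hr hne hbv)]
      exact lip b
    · push Not at hv
      rw [Finset.sum_eq_zero fun r hr => abs_min_sub_min_eq_zero (hu r hr) (hv r hr)]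
      exact hd0 u v
end

section
/- Let V be a finite set and let C be a fractional laminar cut family for a finite terminal set T, with terminal i located at vertex r_i. Then there exists a fractional laminar cut family C' for T and a linear order ≺ on T such that: (1) for every edge, i.e., every pair u,v ∈ V, the load of C' on the pair equals the load of C on the pair; (2) every cut of C'_i contains r_i and the weights of C'_i sum to 1 for each i ∈ T; and (3) for all terminals i ≺ j and all cuts C ∈ C'_i, D ∈ C'_j with r_i, r_j ∈ C ∩ D, one has C ⊆ D (the inclusion invariant). -/
open Finset

namespace FracLaminarFamily

variable {V T : Type} [DecidableEq V] [Fintype T] [DecidableEq T] {r : T → V}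

/-- The ways of redistributing the weight of each cut of `F` among the terminals it contains so
that every terminal still receives total weight `1`. -/
def reassignments (F : FracLaminarFamily V T r) : Set (T → Fin F.n → ℝ) :=
  {x | (∀ i k, 0 ≤ x i k) ∧ (∀ i k, r i ∉ F.cut k → x i k = 0) ∧
    (∀ i, ∑ k, x i k = 1) ∧ ∀ k, ∑ i, x i k = F.wt k}

theorem reassignments_nonempty (F : FracLaminarFamily V T r) : F.reassignments.Nonempty := by
  refine ⟨fun i k => if F.owner k = i then F.wt k else 0, fun i k => ?_, fun i k h => ?_,
    fun i => ?_, fun k => ?_⟩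
  · dsimp only
    split_ifs
    exacts [(F.wt_pos k).le, le_rfl]
  · refine if_neg ?_
    rintro rfl
    exact h (F.root_mem k)
  · rw [← F.wt_sum i, Finset.sum_filter]
  · simp

theorem isCompact_reassignments (F : FracLaminarFamily V T r) : IsCompact F.reassignments := by
  have hbox : IsCompact (Set.univ.pi fun _ : T => Set.univ.pi fun k => Set.Icc 0 (F.wt k)) :=
    isCompact_univ_pi fun _ => isCompact_univ_pi fun _ => isCompact_Icc
  refine hbox.of_isClosed_subset ?_ fun x hx i _ k _ => ⟨hx.1 i k, ?_⟩
  · simp only [reassignments, Set.ofPred_and, Set.ofPred_forall]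
    refine .inter ?_ (.inter ?_ (.inter ?_ ?_))
    · exact isClosed_iInter fun i => isClosed_iInter fun k =>
        isClosed_le continuous_const (by fun_prop)
    · exact isClosed_iInter fun i => isClosed_iInter fun k => isClosed_iInter fun _ =>
        isClosed_eq (by fun_prop) continuous_const
    · exact isClosed_iInter fun i => isClosed_eq (by fun_prop) continuous_const
    · exact isClosed_iInter fun k => isClosed_eq (by fun_prop) continuous_const
  · rw [← hx.2.2.2 k]
    exact Finset.single_le_sum (f := fun i => x i k) (fun i _ => hx.1 i k) (Finset.mem_univ i)

section Support

variable {α β : Type} [Fintype α] [Fintype β]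

/-- An enumeration of the pairs at which `x` is positive. -/
noncomputable def supportEnum (x : α → β → ℝ) :
    Fin (Nat.card {p : α × β // 0 < x p.1 p.2}) ≃ {p : α × β // 0 < x p.1 p.2} :=
  (Finite.equivFin _).symm

theorem sum_supportEnum (x : α → β → ℝ) (g : α → β → ℝ)
    (hg : ∀ a b, ¬ 0 < x a b → g a b = 0) :
    ∑ q, g (supportEnum x q).1.1 (supportEnum x q).1.2 = ∑ a, ∑ b, g a b := by
  classical
  rw [(supportEnum x).sum_comp fun p : {p : α × β // 0 < x p.1 p.2} => g p.1.1 p.1.2,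
    ← Fintype.sum_prod_type' g]
  rw [← Finset.sum_filter_of_ne (p := fun p : α × β => 0 < x p.1 p.2)
    fun p _ hp => not_imp_comm.1 (hg p.1 p.2) hp]
  exact (Finset.sum_subtype _ (by simp) fun p : α × β => g p.1 p.2).symm

end Support

/-- The laminar family obtained from `F` by splitting each cut according to `x`. -/
noncomputable def reassign (F : FracLaminarFamily V T r) (x : T → Fin F.n → ℝ)
    (hx : x ∈ F.reassignments) : FracLaminarFamily V T r where
  n := Nat.card {p : T × Fin F.n // 0 < x p.1 p.2}
  cut q := F.cut (supportEnum x q).1.2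
  wt q := x (supportEnum x q).1.1 (supportEnum x q).1.2
  owner q := (supportEnum x q).1.1
  wt_pos q := (supportEnum x q).2
  laminar _ _ := F.laminar _ _
  root_mem q := by
    by_contra h
    exact (supportEnum x q).2.ne' (hx.2.1 _ _ h)
  wt_sum i := by
    rw [Finset.sum_filter, sum_supportEnum x fun a b => if a = i then x a b else 0]
    · rw [Finset.sum_comm]
      simpa using hx.2.2.1 i
    · intro a b h
      simp [le_antisymm (not_lt.1 h) (hx.1 a b)]

theorem load_reassign (F : FracLaminarFamily V T r) (x : T → Fin F.n → ℝ)
    (hx : x ∈ F.reassignments) (u v : V) : (F.reassign x hx).load u v = F.load u v := by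
  refine (sum_supportEnum x
    (fun a b => if ¬((u ∈ F.cut b) ↔ (v ∈ F.cut b)) then x a b else 0) ?_).trans ?_
  · intro a b h
    simp [le_antisymm (not_lt.1 h) (hx.1 a b)]
  · rw [Finset.sum_comm]
    refine Finset.sum_congr rfl fun k _ => ?_
    split_ifs
    · simp
    · exact hx.2.2.2 k

/-- Moving weight `ε` of cut `c` from `i` to `j` and weight `ε` of cut `d` from `j` to `i`. -/
def exchange {α β : Type} [DecidableEq α] [DecidableEq β] (x : α → β → ℝ) (ε : ℝ) (i j : α)
    (c d : β) (a : α) (b : β) : ℝ :=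
  x a b + ε * ((Pi.single j 1 : α → ℝ) a - (Pi.single i 1 : α → ℝ) a) *
    ((Pi.single c 1 : β → ℝ) b - (Pi.single d 1 : β → ℝ) b)

theorem exchange_mem (F : FracLaminarFamily V T r) {x : T → Fin F.n → ℝ}
    (hx : x ∈ F.reassignments) {ε : ℝ} (hε : 0 ≤ ε) {i j : T} {c d : Fin F.n} (hij : i ≠ j)
    (hcd : c ≠ d) (hic : r i ∈ F.cut c) (hid : r i ∈ F.cut d) (hjc : r j ∈ F.cut c)
    (hjd : r j ∈ F.cut d) (hεi : ε ≤ x i c) (hεj : ε ≤ x j d) :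
    exchange x ε i j c d ∈ F.reassignments := by
  refine ⟨fun a b => ?_, fun a b h => ?_, fun a => ?_, fun b => ?_⟩
  · have := hx.1 a b
    simp only [exchange, Pi.single_apply]
    split_ifs <;> subst_vars <;> first | contradiction | linarith
  · simp only [exchange, Pi.single_apply, hx.2.1 a b h]
    split_ifs <;> subst_vars <;> first | contradiction | simp
  · simp [exchange, Finset.sum_add_distrib, ← Finset.mul_sum, hx.2.2.1 a]
  · simp [exchange, Finset.sum_add_distrib, ← Finset.mul_sum, ← Finset.sum_mul, hx.2.2.2 b]

theorem sum_exchange {α β : Type} [Fintype α] [Fintype β] [DecidableEq α] [DecidableEq β]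
    (x : α → β → ℝ) (ε : ℝ) (i j : α) (c d : β) (f : α → ℝ) (g : β → ℝ) :
    ∑ a, ∑ b, f a * g b * exchange x ε i j c d a b =
      ∑ a, ∑ b, f a * g b * x a b + ε * (f j - f i) * (g c - g d) := by
  have h : ∀ a b, f a * g b * exchange x ε i j c d a b = f a * g b * x a b +
      ε * (f a * ((Pi.single j 1 : α → ℝ) a - (Pi.single i 1 : α → ℝ) a)) *
        (g b * ((Pi.single c 1 : β → ℝ) b - (Pi.single d 1 : β → ℝ) b)) := by
    intro a b
    unfold exchange
    ring
  simp only [h, Finset.sum_add_distrib, ← Finset.mul_sum, ← Finset.sum_mul]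
  simp [mul_sub, Pi.single_apply]

/-- For any ranking of the terminals, the weight can be redistributed so that of two cuts shared
by their owners, the owner of lower rank has the smaller one. -/
theorem exists_reassignment_subset (F : FracLaminarFamily V T r) (rank : T → ℝ) :
    ∃ x ∈ F.reassignments, ∀ i j c d, rank i < rank j → 0 < x i c → 0 < x j d →
      r i ∈ F.cut c → r i ∈ F.cut d → r j ∈ F.cut c → r j ∈ F.cut d → F.cut c ⊆ F.cut d := by
  obtain ⟨x, hx, hmax⟩ := F.isCompact_reassignments.exists_isMaxOn F.reassignments_nonempty
    (f := fun x => ∑ a, ∑ b, rank a * ((F.cut b).card : ℝ) * x a b)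
    (Continuous.continuousOn (by fun_prop))
  refine ⟨x, hx, fun i j c d hij hic hjd hi hi' hj hj' => ?_⟩
  by_contra hcd
  have hdc := (F.laminar c d ⟨r i, Finset.mem_inter.2 ⟨hi, hi'⟩⟩).resolve_left hcd
  have hcard : ((F.cut d).card : ℝ) < (F.cut c).card :=
    Nat.cast_lt.2 (Finset.card_lt_card ⟨hdc, hcd⟩)
  have hε : 0 < min (x i c) (x j d) := lt_min hic hjd
  have hle := isMaxOn_iff.1 hmax _ (F.exchange_mem hx hε.le (ne_of_apply_ne rank hij.ne)
    (fun h : c = d => hcd (h ▸ subset_rfl)) hi hi' hj hj' (min_le_left _ _) (min_le_right _ _))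
  rw [sum_exchange x _ i j c d rank fun b => ((F.cut b).card : ℝ)] at hle
  have := mul_pos (mul_pos hε (sub_pos.2 hij)) (sub_pos.2 hcard)
  linarith

end FracLaminarFamily

/-- **The inclusion invariant can be established by preprocessing.**
Given a fractional laminar cut family `F` for terminals `T` located at
vertices `r i`, there is a fractional laminar cut family `F'` for `T` and a
strict linear order `≺` on `T` such that the load of `F'` on every pair
`u, v` equals that of `F` (the conditions that every cut owned by `i`
contains `r i` and that the weights owned by each terminal sum to `1` are
part of the structure `FracLaminarFamily`), and for all terminals `i ≺ j`
and cuts `C` owned by `i` and `D` owned by `j` with `r i, r j ∈ C ∩ D`, one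
has `C ⊆ D`. -/
theorem inclusion_invariant_preprocessing
    {V T : Type} [Fintype V] [DecidableEq V] [Fintype T] [DecidableEq T]
    (r : T → V) (F : FracLaminarFamily V T r) :
    ∃ (F' : FracLaminarFamily V T r) (lt : T → T → Prop),
      IsStrictTotalOrder T lt ∧
      (∀ u v : V, F'.load u v = F.load u v) ∧
      (∀ i j : T, lt i j →
        ∀ jc jc' : Fin F'.n, F'.owner jc = i → F'.owner jc' = j →
          r i ∈ F'.cut jc ∩ F'.cut jc' → r j ∈ F'.cut jc ∩ F'.cut jc' →
          F'.cut jc ⊆ F'.cut jc') := by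
  let e := Fintype.equivFin T
  obtain ⟨x, hx, hsub⟩ := F.exists_reassignment_subset fun i => ((e i : ℕ) : ℝ)
  refine ⟨F.reassign x hx, fun i j => e i < e j,
    (RelEmbedding.preimage e.toEmbedding (· < ·)).isStrictTotalOrder, F.load_reassign x hx, ?_⟩
  rintro _ _ hij q q' rfl rfl hi hj
  rw [Finset.mem_inter] at hi hj
  exact hsub _ _ _ _ (Nat.cast_lt.2 hij) (FracLaminarFamily.supportEnum x q).2
    (FracLaminarFamily.supportEnum x q').2 hi.1 hi.2 hj.1 hj.2
end
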